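/- arXiv:1502.05576 — 4 statements merged into one kernel-verified Lean document; each statement's English description precedes it below -/
import Mathlib

section
/- Let A be a densely defined linear operator on a complex Hilbert space H and let θ ∈ (0, π/2). If A, e^{iθ}A and e^{-iθ}A all generate quasicontractive C₀-semigroups on H, then A generates an analytic C₀-semigroup on the sector Σ_θ = {re^{iα} : r ≥ 0, |α| < θ}. -/
open Complex MeasureTheory Filter Set Metric
open scoped Real Topology ENNReal

noncomputable section

/-- The weighted Hardy space `H²(β)`, modeled as the `ℓ²` space of weighted
Taylor coefficient sequences: the function `f(z) = Σ cₙ zⁿ` corresponds to the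
square-summable sequence `(cₙ βₙ)ₙ`. -/
abbrev WH2 : Type := lp (fun _ : ℕ => ℂ) 2

/-- The analytic function on the unit disc associated to an element of `H²(β)`. -/
def wToFun (β : ℕ → ℝ) (f : WH2) (z : ℂ) : ℂ := ∑' n : ℕ, (f n / (β n : ℂ)) * z ^ n

/-- The open unit disc. -/
def uDisc : Set ℂ := Metric.ball 0 1

/-- Weights of the classical Hardy space `H²(𝔻)` (`βₙ = 1`). -/
def hardyW : ℕ → ℝ := fun _ => 1

/-- Weights of the Dirichlet space `𝒟` (`β₀ = 1`, `βₙ = √n`). -/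
def dirichletW : ℕ → ℝ := fun n => if n = 0 then 1 else Real.sqrt n

/-- The monomial `eₙ(z) = zⁿ` as an element of `H²(β)`. -/
def eW (β : ℕ → ℝ) (n : ℕ) : WH2 := lp.single 2 n ((β n : ℝ) : ℂ)

/-- `T` acts as the composition operator with analytic self-map symbol `φ` on `H²(β)`. -/
def RepresentsComp (β : ℕ → ℝ) (T : WH2 →L[ℂ] WH2) (φ : ℂ → ℂ) : Prop :=
  DifferentiableOn ℂ φ uDisc ∧ MapsTo φ uDisc uDisc ∧
  ∀ f : WH2, ∀ z ∈ uDisc, wToFun β (T f) z = wToFun β f (φ z)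

/-- `T` is a composition operator on `H²(β)`. -/
def IsCompositionOperator (β : ℕ → ℝ) (T : WH2 →L[ℂ] WH2) : Prop :=
  ∃ φ : ℂ → ℂ, RepresentsComp β T φ

/-- `T` is a weighted composition operator `f ↦ w · (f ∘ φ)` on `H²(𝔻)`. -/
def IsWeightedCompOp (T : WH2 →L[ℂ] WH2) : Prop :=
  ∃ w φ : ℂ → ℂ, DifferentiableOn ℂ w uDisc ∧ DifferentiableOn ℂ φ uDisc ∧
    MapsTo φ uDisc uDisc ∧
    ∀ f : WH2, ∀ z ∈ uDisc, wToFun hardyW (T f) z = w z * wToFun hardyW f (φ z)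

section Semigroup

variable {X : Type*} [NormedAddCommGroup X] [NormedSpace ℂ X]

/-- `T` is a `C₀`-semigroup (indexed by `t ≥ 0`). -/
def IsC0Semigroup (T : ℝ → X →L[ℂ] X) : Prop :=
  T 0 = 1 ∧ (∀ s t : ℝ, 0 ≤ s → 0 ≤ t → T (s + t) = (T s).comp (T t)) ∧
  ∀ x : X, Tendsto (fun t : ℝ => T t x) (𝓝[≥] 0) (𝓝 x)

/-- `T` is a `C₀`-group (indexed by `t ∈ ℝ`). -/
def IsC0Group (T : ℝ → X →L[ℂ] X) : Prop :=
  T 0 = 1 ∧ (∀ s t : ℝ, T (s + t) = (T s).comp (T t)) ∧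
  ∀ x : X, Tendsto (fun t : ℝ => T t x) (𝓝 0) (𝓝 x)

/-- Quasicontractive: `‖T(t)‖ ≤ e^{wt}` for some `w ≥ 0` and all `t ≥ 0`. -/
def Quasicontractive (T : ℝ → X →L[ℂ] X) : Prop :=
  ∃ w : ℝ, 0 ≤ w ∧ ∀ t : ℝ, 0 ≤ t → ‖T t‖ ≤ Real.exp (w * t)

/-- The sector `Σ_θ = {re^{iα} : r ≥ 0, |α| < θ}` (note `arg 0 = 0`). -/
def Sector (θ : ℝ) : Set ℂ := {z : ℂ | |Complex.arg z| < θ}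

/-- `Te` is an analytic extension of the semigroup `T` to the sector `Σ_θ`,
bounded on `Σ_θ ∩ 𝔻`. -/
def IsAnalyticExtension (T : ℝ → X →L[ℂ] X) (θ : ℝ) (Te : ℂ → X →L[ℂ] X) : Prop :=
  (∀ t : ℝ, 0 ≤ t → Te t = T t) ∧
  DifferentiableOn ℂ Te (Sector θ \ {0}) ∧
  ∃ M : ℝ, ∀ ξ ∈ Sector θ, ‖ξ‖ < 1 → ‖Te ξ‖ ≤ M

/-- The semigroup `T` extends analytically and boundedly to the sector `Σ_θ`. -/
def HasAnalyticExtension (T : ℝ → X →L[ℂ] X) (θ : ℝ) : Prop :=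
  ∃ Te : ℂ → X →L[ℂ] X, IsAnalyticExtension T θ Te

/-- The semigroup `T` is analytic (on some sector `Σ_θ`, `θ ∈ (0, π/2]`). -/
def IsAnalyticSemigroup (T : ℝ → X →L[ℂ] X) : Prop :=
  ∃ θ ∈ Set.Ioc 0 (π / 2), HasAnalyticExtension T θ

/-- `y` is the limit of `(T(t)x - x)/t` as `t → 0⁺`. -/
def GenLimit (T : ℝ → X →L[ℂ] X) (x y : X) : Prop :=
  Tendsto (fun t : ℝ => (t : ℂ)⁻¹ • (T t x - x)) (𝓝[>] 0) (𝓝 y)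

/-- `A`, with domain `D`, is the infinitesimal generator of the semigroup `T`. -/
def IsGenerator (T : ℝ → X →L[ℂ] X) (D : Set X) (A : X → X) : Prop :=
  (∀ x ∈ D, GenLimit T x (A x)) ∧ ∀ x : X, (∃ y, GenLimit T x y) → x ∈ D

/-- `y` is the two-sided limit of `(T(t)x - x)/t` as `t → 0` (for groups). -/
def GenLimitGrp (T : ℝ → X →L[ℂ] X) (x y : X) : Prop :=
  Tendsto (fun t : ℝ => (t : ℂ)⁻¹ • (T t x - x)) (𝓝[≠] 0) (𝓝 y)

/-- `A`, with domain `D`, is the infinitesimal generator of the group `T`. -/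
def IsGeneratorGrp (T : ℝ → X →L[ℂ] X) (D : Set X) (A : X → X) : Prop :=
  (∀ x ∈ D, GenLimitGrp T x (A x)) ∧ ∀ x : X, (∃ y, GenLimitGrp T x y) → x ∈ D

/-- Immediately compact semigroup: `T(t)` is compact for all `t > 0`. -/
def ImmediatelyCompact (T : ℝ → X →L[ℂ] X) : Prop :=
  ∀ t : ℝ, 0 < t → IsCompactOperator (T t)

/-- Eventually compact semigroup: `T(t)` is compact for all `t ≥ t₀`, some `t₀ > 0`. -/
def EventuallyCompact (T : ℝ → X →L[ℂ] X) : Prop :=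
  ∃ t₀ : ℝ, 0 < t₀ ∧ ∀ t : ℝ, t₀ ≤ t → IsCompactOperator (T t)

end Semigroup

/-- The natural domain of the operator `A f = G f'` in `H²(β)`: those `f` for which
`G · (wToFun β f)'` is realized by some element of `H²(β)`. -/
def domA (β : ℕ → ℝ) (G : ℂ → ℂ) : Set WH2 :=
  {f : WH2 | ∃ g : WH2, ∀ z ∈ uDisc, wToFun β g z = G z * deriv (wToFun β f) z}

open Classical in
/-- The operator `A f = G f'` on `H²(β)` (defined via choice on its natural domain). -/
def opA (β : ℕ → ℝ) (G : ℂ → ℂ) (f : WH2) : WH2 :=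
  if h : f ∈ domA β G then h.choose else 0

/-- `(φ_t)_{t ≥ 0}` is a (jointly continuous) semiflow of analytic self-maps of `𝔻`. -/
def IsSemiflow (φ : ℝ → ℂ → ℂ) : Prop :=
  (∀ z ∈ uDisc, φ 0 z = z) ∧
  (∀ t : ℝ, 0 ≤ t → DifferentiableOn ℂ (φ t) uDisc ∧ MapsTo (φ t) uDisc uDisc) ∧
  (∀ s t : ℝ, 0 ≤ s → 0 ≤ t → ∀ z ∈ uDisc, φ (s + t) z = φ s (φ t z)) ∧
  ContinuousOn (fun p : ℝ × ℂ => φ p.1 p.2) (Set.Ici 0 ×ˢ uDisc)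

/-- `G` is the infinitesimal generator of the semiflow `φ`: `∂φ_t/∂t = G ∘ φ_t`. -/
def SemiflowGenerator (φ : ℝ → ℂ → ℂ) (G : ℂ → ℂ) : Prop :=
  ∀ z ∈ uDisc, ∀ t : ℝ, 0 ≤ t → HasDerivAt (fun s : ℝ => φ s z) (G (φ t z)) t

/-- Hilbert–Schmidt operator on `WH2` (w.r.t. the standard orthonormal basis). -/
def IsHilbertSchmidt (T : WH2 →L[ℂ] WH2) : Prop :=
  Summable (fun n : ℕ => ‖T (lp.single 2 n (1 : ℂ))‖ ^ 2)

/-- Trace-class operator on `WH2`: a product of two Hilbert–Schmidt operators. -/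
def IsTraceClass (T : WH2 →L[ℂ] WH2) : Prop :=
  ∃ A B : WH2 →L[ℂ] WH2, IsHilbertSchmidt A ∧ IsHilbertSchmidt B ∧ T = A.comp B

/-- `‖φ‖_∞ < 1` for a function on the unit disc. -/
def SupNormLtOne (φ : ℂ → ℂ) : Prop :=
  ∃ r : ℝ, r < 1 ∧ ∀ z ∈ uDisc, ‖φ z‖ ≤ r

/-- Essential boundary condition via radial limits: for almost every boundary point
`ξ = e^{it}`, whenever the radial limit `L` of `G` at `ξ` exists,
`Re (e^{iα} ξ̄ L) ≤ c`.  (This encodes `ess sup_(z ∈ 𝕋) Re (e^{iα} z̄ G(z)) ≤ c`.) -/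
def BoundaryReLe (G : ℂ → ℂ) (α : ℝ) (c : ℝ) : Prop :=
  ∀ᵐ t : ℝ, ∀ L : ℂ,
    Tendsto (fun r : ℝ => G ((r : ℂ) * Complex.exp ((t : ℂ) * Complex.I)))
      (𝓝[<] 1) (𝓝 L) →
    (Complex.exp ((α : ℂ) * Complex.I) *
      (starRingEnd ℂ) (Complex.exp ((t : ℂ) * Complex.I)) * L).re ≤ c

/-- `Re (z̄ G(z)) = 0` almost everywhere on the unit circle, via radial limits. -/
def BoundaryReEqZero (G : ℂ → ℂ) : Prop :=
  ∀ᵐ t : ℝ, ∀ L : ℂ,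
    Tendsto (fun r : ℝ => G ((r : ℂ) * Complex.exp ((t : ℂ) * Complex.I)))
      (𝓝[<] 1) (𝓝 L) →
    ((starRingEnd ℂ) (Complex.exp ((t : ℂ) * Complex.I)) * L).re = 0

end

section StrongHolomorphy

variable {X Y : Type*} [NormedAddCommGroup X] [NormedSpace ℂ X]
  [NormedAddCommGroup Y] [NormedSpace ℂ Y]

/-- An operator norm bound only needs to be checked on a dense set. -/
lemma opNorm_le_bound_of_dense {D : Set X} (hD : Dense D) (f : X →L[ℂ] Y) {K : ℝ} (hK : 0 ≤ K)
    (h : ∀ x ∈ D, ‖f x‖ ≤ K * ‖x‖) : ‖f‖ ≤ K := by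
  refine f.opNorm_le_bound hK fun x => ?_
  have hc : IsClosed {x : X | ‖f x‖ ≤ K * ‖x‖} :=
    isClosed_le f.continuous.norm (continuous_const.mul continuous_norm)
  exact closure_minimal (s := D) h hc (hD x)

/-- A bounded operator-valued function which is strongly holomorphic on a dense set is norm
continuous. -/
lemma continuousAt_of_strong_differentiableOn {D : Set X} (hD : Dense D) {F : ℂ → X →L[ℂ] Y}
    {c : ℂ} {R M : ℝ} (hR : 0 < R) (hM : ∀ z ∈ ball c R, ‖F z‖ ≤ M)
    (hF : ∀ x ∈ D, DifferentiableOn ℂ (fun z => F z x) (ball c R)) : ContinuousAt F c := by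
  have hM0 : 0 ≤ M := (norm_nonneg _).trans (hM c (mem_ball_self hR))
  have key : ∀ z ∈ ball c R, ‖F z - F c‖ ≤ 2 * M / R * dist z c := by
    intro z hz
    refine opNorm_le_bound_of_dense hD _ (by positivity) fun x hx => ?_
    have hmaps : MapsTo (fun z => F z x) (ball c R) (closedBall (F c x) (2 * M * ‖x‖)) := by
      intro w hw
      rw [mem_closedBall, dist_eq_norm]
      have h1 := (F w).le_of_opNorm_le (hM w hw) x
      have h2 := (F c).le_of_opNorm_le (hM c (mem_ball_self hR)) x
      calc ‖F w x - F c x‖ ≤ ‖F w x‖ + ‖F c x‖ := norm_sub_le _ _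
        _ ≤ 2 * M * ‖x‖ := by linarith
    have h := Complex.dist_le_div_mul_dist_of_mapsTo_ball (hF x hx) hmaps hz
    rw [dist_eq_norm] at h
    calc ‖(F z - F c) x‖ = ‖F z x - F c x‖ := by simp
      _ ≤ _ := h
      _ = _ := by ring
  rw [ContinuousAt, tendsto_iff_norm_sub_tendsto_zero]
  have hlim : Tendsto (fun z => 2 * M / R * dist z c) (𝓝 c) (𝓝 0) := by
    have : ContinuousAt (fun z => 2 * M / R * dist z c) c := by fun_prop
    simpa [ContinuousAt] using this
  refine squeeze_zero' (Eventually.of_forall fun _ => norm_nonneg _) ?_ hlim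
  filter_upwards [ball_mem_nhds c hR] with z hz using key z hz

/-- A bounded operator-valued function which is strongly holomorphic on a dense set is
holomorphic in the operator norm. -/
lemma differentiableOn_of_strong_differentiableOn [CompleteSpace Y] {D : Set X} (hD : Dense D)
    {F : ℂ → X →L[ℂ] Y} {U : Set ℂ} (hU : IsOpen U)
    (hM : ∀ c ∈ U, ∃ M, ∀ᶠ z in 𝓝 c, ‖F z‖ ≤ M)
    (hF : ∀ x ∈ D, DifferentiableOn ℂ (fun z => F z x) U) : DifferentiableOn ℂ F U := by
  have hcont : ContinuousOn F U := by
    intro c hc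
    obtain ⟨M, hM⟩ := hM c hc
    obtain ⟨R, hR, hball⟩ := Metric.mem_nhds_iff.1 (inter_mem hM (hU.mem_nhds hc))
    exact (continuousAt_of_strong_differentiableOn hD hR (fun z hz => (hball hz).1)
      fun x hx => (hF x hx).mono fun z hz => (hball hz).2).continuousWithinAt
  intro c hc
  obtain ⟨r, hr, hball⟩ := Metric.nhds_basis_closedBall.mem_iff.1 (hU.mem_nhds hc)
  lift r to NNReal using hr.le
  have hFc : ContinuousOn F (sphere c r) := hcont.mono (sphere_subset_closedBall.trans hball)
  have hdiff := (hasFPowerSeriesOn_cauchy_integral (hFc.circleIntegrable hr.le)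
    (by exact_mod_cast hr)).differentiableOn
  rw [Metric.eball_coe] at hdiff
  refine DifferentiableAt.differentiableWithinAt ?_
  refine (hdiff.differentiableAt (ball_mem_nhds c hr)).congr_of_eventuallyEq ?_
  filter_upwards [ball_mem_nhds c hr] with w hw
  refine DFunLike.coe_injective (Continuous.ext_on hD (F w).continuous
    (ContinuousLinearMap.continuous _) fun x hx => ?_)
  have hint : CircleIntegrable (fun z => (z - w)⁻¹ • F z) c r := by
    refine ContinuousOn.circleIntegrable hr.le (ContinuousOn.fun_smul ?_ hFc)
    refine ContinuousOn.inv₀ (by fun_prop) fun z hz h0 => ?_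
    rw [sub_eq_zero.1 h0, mem_sphere] at hz
    exact (mem_ball.1 hw).ne hz
  have happ : (∮ z in C(c, r), (z - w)⁻¹ • F z) x = ∮ z in C(c, r), (z - w)⁻¹ • F z x :=
    ContinuousLinearMap.intervalIntegral_apply hint.out x
  rw [smul_apply, happ,
    ((hF x hx).mono hball).circleIntegral_sub_inv_smul hw, inv_smul_smul₀ Complex.two_pi_I_ne_zero]

end StrongHolomorphy

section Semigroup

variable {X : Type*} [NormedAddCommGroup X] [NormedSpace ℂ X]
  {T : ℝ → X →L[ℂ] X} {D : Set X} {B : X → X}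

/-- Increments of a semigroup factor through the earlier time. -/
lemma IsC0Semigroup.sub_apply_of_le (hT : IsC0Semigroup T) {s t : ℝ} (hs : 0 ≤ s) (hst : s ≤ t)
    (x : X) : T t x - T s x = T s (T (t - s) x - x) := by
  have h := hT.2.1 s (t - s) hs (sub_nonneg.2 hst)
  rw [add_sub_cancel] at h
  rw [h, map_sub]; rfl

/-- Uniform bound for a quasicontractive semigroup on `[0, a]`. -/
lemma Quasicontractive.exists_bound (hq : Quasicontractive T) :
    ∃ w : ℝ, ∀ a t : ℝ, 0 ≤ t → t ≤ a → ‖T t‖ ≤ Real.exp (w * a) := by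
  obtain ⟨w, hw, h⟩ := hq
  exact ⟨w, fun a t ht hta => (h t ht).trans (by gcongr)⟩

lemma IsC0Semigroup.continuousOn_apply (hT : IsC0Semigroup T) (hq : Quasicontractive T) (x : X) :
    ContinuousOn (fun t => T t x) (Ici 0) := by
  obtain ⟨w, hw⟩ := hq.exists_bound
  intro t ht
  rw [ContinuousWithinAt, tendsto_iff_norm_sub_tendsto_zero]
  have hlim : Tendsto (fun s => Real.exp (w * t) * ‖T |s - t| x - x‖) (𝓝[Ici 0] t) (𝓝 0) := by
    have h0 : Tendsto (fun s : ℝ => |s - t|) (𝓝[Ici 0] t) (𝓝[≥] 0) := by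
      refine tendsto_nhdsWithin_iff.2 ⟨?_, Eventually.of_forall fun s => mem_Ici.2 (abs_nonneg _)⟩
      have : ContinuousAt (fun s : ℝ => |s - t|) t := by fun_prop
      exact tendsto_nhdsWithin_of_tendsto_nhds (by simpa [ContinuousAt] using this)
    have h1 := (((hT.2.2 x).comp h0).sub_const x).norm.const_mul (Real.exp (w * t))
    simpa using h1
  refine squeeze_zero' (Eventually.of_forall fun _ => norm_nonneg _) ?_ hlim
  filter_upwards [self_mem_nhdsWithin] with s hs
  rcases le_total s t with hst | hst
  · rw [norm_sub_rev, hT.sub_apply_of_le hs hst, abs_sub_comm, abs_of_nonneg (sub_nonneg.2 hst)]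
    exact (T s).le_of_opNorm_le (hw t s hs hst) _
  · rw [hT.sub_apply_of_le ht hst, abs_of_nonneg (sub_nonneg.2 hst)]
    exact (T t).le_of_opNorm_le (hw t t ht le_rfl) _

/-- Joint continuity of a semigroup along an arbitrary filter. -/
lemma IsC0Semigroup.tendsto_apply (hT : IsC0Semigroup T) (hq : Quasicontractive T)
    {ι : Type*} {l : Filter ι} {g : ι → ℝ} {v : ι → X} {t : ℝ} {y : X} (ht : 0 ≤ t)
    (hg : Tendsto g l (𝓝 t)) (hg0 : ∀ᶠ i in l, 0 ≤ g i) (hv : Tendsto v l (𝓝 y)) :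
    Tendsto (fun i => T (g i) (v i)) l (𝓝 (T t y)) := by
  obtain ⟨w, hw⟩ := hq.exists_bound
  have h1 : Tendsto (fun i => T (g i) y) l (𝓝 (T t y)) :=
    (hT.continuousOn_apply hq y t ht).tendsto.comp (tendsto_nhdsWithin_iff.2 ⟨hg, hg0⟩)
  have h2 : Tendsto (fun i => T (g i) (v i - y)) l (𝓝 0) := by
    have hlim : Tendsto (fun i => Real.exp (w * (t + 1)) * ‖v i - y‖) l (𝓝 0) := by
      simpa using (hv.sub_const y).norm.const_mul (Real.exp (w * (t + 1)))
    refine squeeze_zero_norm' ?_ hlim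
    filter_upwards [hg0, hg.eventually_le_const (lt_add_one t)] with i h0 h1
    exact (T (g i)).le_of_opNorm_le (hw _ _ h0 h1) _
  simpa using h2.add h1

/-- A semigroup preserves the domain of its generator and commutes with the generator. -/
lemma IsGenerator.apply_mem (hT : IsC0Semigroup T) (hB : IsGenerator T D B) {x : X} (hx : x ∈ D)
    {t : ℝ} (ht : 0 ≤ t) : T t x ∈ D ∧ B (T t x) = T t (B x) := by
  have h : GenLimit T (T t x) (T t (B x)) := by
    refine (((T t).continuous.tendsto _).comp (hB.1 x hx)).congr' ?_
    filter_upwards [self_mem_nhdsWithin] with h hh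
    have hc : (T t) ((T h) x) = T h (T t x) := by
      rw [← ContinuousLinearMap.comp_apply, ← ContinuousLinearMap.comp_apply,
        ← hT.2.1 t h ht hh.le, ← hT.2.1 h t hh.le ht, add_comm]
    simp [hc]
  have hmem := hB.2 _ ⟨_, h⟩
  exact ⟨hmem, tendsto_nhds_unique (hB.1 _ hmem) h⟩

/-- Orbits starting in the domain of the generator are differentiable. -/
lemma IsGenerator.hasDerivAt (hT : IsC0Semigroup T) (hq : Quasicontractive T)
    (hB : IsGenerator T D B) {x : X} (hx : x ∈ D) {t : ℝ} (ht : 0 < t) :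
    HasDerivAt (fun s => T s x) (T t (B x)) t := by
  rw [hasDerivAt_iff_tendsto_slope]
  have habs : Tendsto (fun s : ℝ => |s - t|) (𝓝[≠] t) (𝓝[>] 0) := by
    refine tendsto_nhdsWithin_iff.2 ⟨?_, ?_⟩
    · have : ContinuousAt (fun s : ℝ => |s - t|) t := by fun_prop
      exact tendsto_nhdsWithin_of_tendsto_nhds (by simpa [ContinuousAt] using this)
    · filter_upwards [self_mem_nhdsWithin] with s hs using abs_pos.2 (sub_ne_zero.2 hs)
  have hmin : Tendsto (fun s : ℝ => min s t) (𝓝[≠] t) (𝓝 t) := by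
    have : ContinuousAt (fun s : ℝ => min s t) t := by fun_prop
    exact tendsto_nhdsWithin_of_tendsto_nhds (by simpa [ContinuousAt] using this)
  have hpos : ∀ᶠ s in 𝓝[≠] t, 0 < min s t := hmin.eventually_const_lt ht
  refine (hT.tendsto_apply hq ht.le hmin (hpos.mono fun _ h => h.le)
    ((hB.1 x hx).comp habs)).congr' ?_
  filter_upwards [hpos] with s hs
  have hs0 : 0 ≤ s := (hs.trans_le (min_le_left _ _)).le
  simp only [Function.comp_apply, slope_def_module, map_smul]
  rw [← Complex.ofReal_inv, Complex.coe_smul]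
  rcases le_total s t with hst | hst
  · rw [min_eq_left hst, abs_sub_comm, abs_of_nonneg (sub_nonneg.2 hst),
      ← hT.sub_apply_of_le hs0 hst, ← neg_sub t s, ← neg_sub (T t x) (T s x), inv_neg, neg_smul_neg]
  · rw [min_eq_right hst, abs_of_nonneg (sub_nonneg.2 hst), ← hT.sub_apply_of_le ht.le hst]

/-- Product rule for `e ↦ S (g e) (v e)`. -/
lemma IsGenerator.hasFDerivAt_comp {E : Type*} [NormedAddCommGroup E] [NormedSpace ℝ E]
    (hT : IsC0Semigroup T) (hq : Quasicontractive T) (hB : IsGenerator T D B)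
    {g : E → ℝ} {v : E → X} {g' ℓ : E →L[ℝ] ℝ} {y : X} {e : E}
    (hg : HasFDerivAt g g' e) (hv : HasFDerivAt v (ℓ.smulRight y) e) (hge : 0 < g e)
    (hve : v e ∈ D) :
    HasFDerivAt (fun e' => T (g e') (v e'))
      (ℓ.smulRight (T (g e) y) + g'.smulRight (T (g e) (B (v e)))) e := by
  obtain ⟨w, hw⟩ := hq.exists_bound
  have hg0 : ∀ᶠ e' in 𝓝 e, 0 ≤ g e' :=
    (hg.continuousAt.eventually_const_lt hge).mono fun _ h => h.le
  have hg1 : ∀ᶠ e' in 𝓝 e, g e' ≤ g e + 1 :=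
    hg.continuousAt.eventually_le_const (lt_add_one _)
  have t1 : (fun e' => T (g e') (v e' - v e - ℓ (e' - e) • y)) =o[𝓝 e] fun e' => e' - e := by
    refine Asymptotics.IsBigO.trans_isLittleO ?_ hv.isLittleO
    refine Asymptotics.IsBigO.of_bound (Real.exp (w * (g e + 1))) ?_
    filter_upwards [hg0, hg1] with e' h0 h1
    exact (T (g e')).le_of_opNorm_le (hw _ _ h0 h1) _
  have t2 : (fun e' => ℓ (e' - e) • (T (g e') y - T (g e) y)) =o[𝓝 e] fun e' => e' - e := by
    have hlim : Tendsto (fun e' => T (g e') y - T (g e) y) (𝓝 e) (𝓝 0) := by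
      simpa using (hT.tendsto_apply hq hge.le hg.continuousAt hg0
        (tendsto_const_nhds (x := y))).sub_const (T (g e) y)
    have := (ℓ.isBigO_comp (fun e' => e' - e) (𝓝 e)).norm_right.smul_isLittleO
      ((Asymptotics.isLittleO_one_iff ℝ).2 hlim)
    refine this.trans_isBigO ?_
    simpa using (Asymptotics.isBigO_refl (fun e' => e' - e) (𝓝 e)).norm_left
  have t3 := ((hB.hasDerivAt hT hq hve hge).hasFDerivAt.comp e hg).isLittleO
  refine HasFDerivAt.of_isLittleO ((t1.add (t2.add t3)).congr_left fun e' => ?_)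
  have hre : ∀ (a : ℝ) (S : X →L[ℂ] X) (z : X), S (a • z) = a • S z := fun a S z => by
    rw [← Complex.coe_smul, map_smul, Complex.coe_smul]
  simp only [map_sub, hre, smul_sub, Function.comp_apply, add_apply,
    ContinuousLinearMap.smulRight_apply, sub_smul]
  abel

/-- A function continuous on `[0, r]` with zero derivative on `(0, r)` has equal end values. -/
lemma eq_of_hasDerivAt_zero_Ioo {E : Type*} [NormedAddCommGroup E] [NormedSpace ℝ E] {f : ℝ → E}
    {r : ℝ} (hr : 0 < r) (hc : ContinuousOn f (Icc 0 r))
    (hd : ∀ s ∈ Ioo 0 r, HasDerivAt f 0 s) : f r = f 0 := by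
  have h1 : ∀ ε ∈ Ioo 0 r, f r = f ε := fun ε hε =>
    constant_of_has_deriv_right_zero (hc.mono (Icc_subset_Icc_left hε.1.le))
      (fun s hs => (hd s ⟨hε.1.trans_le hs.1, hs.2⟩).hasDerivWithinAt) r ⟨hε.2.le, le_rfl⟩
  have h2 : Tendsto f (𝓝[Ioo 0 r] 0) (𝓝 (f 0)) :=
    (hc 0 ⟨le_rfl, hr.le⟩).tendsto.mono_left (nhdsWithin_mono _ Ioo_subset_Icc_self)
  have : (𝓝[Ioo 0 r] (0 : ℝ)).NeBot := by
    rw [nhdsWithin_Ioo_eq_nhdsGT hr]; infer_instance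
  refine tendsto_nhds_unique (tendsto_const_nhds.congr' ?_) h2
  filter_upwards [self_mem_nhdsWithin] with ε hε using h1 ε hε

/-- Uniqueness of solutions of the abstract Cauchy problem `u' = B u`. -/
lemma IsGenerator.eq_apply_of_hasDerivAt (hT : IsC0Semigroup T) (hq : Quasicontractive T)
    (hB : IsGenerator T D B) {u : ℝ → X} {r : ℝ} (hr : 0 < r)
    (hc : ContinuousOn u (Icc 0 r)) (hu : ∀ s ∈ Ioo 0 r, u s ∈ D ∧ HasDerivAt u (B (u s)) s) :
    u r = T r (u 0) := by
  have h : T (r - r) (u r) = T (r - 0) (u 0) := by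
    refine eq_of_hasDerivAt_zero_Ioo (f := fun s => T (r - s) (u s)) hr ?_ ?_
    · intro s hs
      refine hT.tendsto_apply hq (sub_nonneg.2 hs.2) ?_ ?_ (hc s hs)
      · exact (continuous_const.sub continuous_id).continuousWithinAt
      · filter_upwards [self_mem_nhdsWithin] with i hi using sub_nonneg.2 hi.2
    · intro s hs
      have hg : HasDerivAt (fun s => r - s) (-1) s := by
        simpa using (hasDerivAt_id s).const_sub r
      have hv : HasFDerivAt u ((1 : ℝ →L[ℝ] ℝ).smulRight (B (u s))) s := by
        have h1 : ContinuousLinearMap.toSpanSingleton ℝ (B (u s)) =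
            (1 : ℝ →L[ℝ] ℝ).smulRight (B (u s)) := by ext; simp
        exact h1 ▸ (hu s hs).2.hasFDerivAt
      have := (hB.hasFDerivAt_comp hT hq hg.hasFDerivAt hv (sub_pos.2 hs.2) (hu s hs).1).hasDerivAt
      simpa using this
  simpa [hT.1] using h

end Semigroup

section Rotation

/-- The coefficient functionals `c` with `z = c θ z • e^{iθ} + c (-θ) z • e^{-iθ}`. -/
noncomputable def rayCoord (θ : ℝ) : ℂ →L[ℝ] ℝ :=
  (2 * Real.cos θ)⁻¹ • Complex.reCLM + (2 * Real.sin θ)⁻¹ • Complex.imCLM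

lemma rayCoord_apply (θ : ℝ) (z : ℂ) :
    rayCoord θ z = (2 * Real.cos θ)⁻¹ * z.re + (2 * Real.sin θ)⁻¹ * z.im := by
  simp [rayCoord]

variable {θ : ℝ}

lemma rayCoord_neg_apply (θ : ℝ) (z : ℂ) :
    rayCoord (-θ) z = (2 * Real.cos θ)⁻¹ * z.re - (2 * Real.sin θ)⁻¹ * z.im := by
  rw [rayCoord_apply, Real.cos_neg, Real.sin_neg, mul_neg, inv_neg]; ring

lemma rayCoord_decomp (hθ : θ ∈ Ioo 0 (π / 2)) (z : ℂ) :
    (rayCoord θ z : ℂ) * Complex.exp ((θ : ℂ) * I) +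
      (rayCoord (-θ) z : ℂ) * Complex.exp (-(θ : ℂ) * I) = z := by
  have hc : Real.cos θ ≠ 0 := (Real.cos_pos_of_mem_Ioo ⟨by linarith [hθ.1, Real.pi_pos], hθ.2⟩).ne'
  have hs : Real.sin θ ≠ 0 := (Real.sin_pos_of_pos_of_lt_pi hθ.1 (by linarith [hθ.2, Real.pi_pos])).ne'
  rw [← Complex.ofReal_neg, Complex.exp_mul_I, Complex.exp_mul_I,
    ← Complex.ofReal_cos, ← Complex.ofReal_sin, ← Complex.ofReal_cos, ← Complex.ofReal_sin, Real.cos_neg,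
    Real.sin_neg,
    rayCoord_apply, rayCoord_neg_apply]
  apply Complex.ext
  · simp [-Complex.ofReal_cos, -Complex.ofReal_sin]
    field_simp
    ring
  · simp [-Complex.ofReal_cos, -Complex.ofReal_sin]
    field_simp
    ring

lemma rayCoord_ofReal (θ t : ℝ) : rayCoord θ (t : ℂ) = (2 * Real.cos θ)⁻¹ * t := by
  simp [rayCoord_apply]

lemma rayCoord_pos (hθ : θ ∈ Ioo 0 (π / 2)) {z : ℂ} (hz : z ∈ Sector θ \ {0}) :
    0 < rayCoord θ z ∧ 0 < rayCoord (-θ) z := by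
  have hc : 0 < Real.cos θ := Real.cos_pos_of_mem_Ioo ⟨by linarith [hθ.1, Real.pi_pos], hθ.2⟩
  have hs : 0 < Real.sin θ := Real.sin_pos_of_pos_of_lt_pi hθ.1 (by linarith [hθ.2, Real.pi_pos])
  have hn : 0 < ‖z‖ := norm_pos_iff.2 hz.2
  obtain ⟨h1, h2⟩ := abs_lt.1 (show |Complex.arg z| < θ from hz.1)
  have hplus : 0 < Real.sin (θ + z.arg) :=
    Real.sin_pos_of_pos_of_lt_pi (by linarith) (by linarith [hθ.2])
  have hminus : 0 < Real.sin (θ - z.arg) :=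
    Real.sin_pos_of_pos_of_lt_pi (by linarith) (by linarith [hθ.2])
  rw [Real.sin_add] at hplus
  rw [Real.sin_sub] at hminus
  rw [rayCoord_apply, rayCoord_neg_apply, ← Complex.norm_mul_cos_arg z,
    ← Complex.norm_mul_sin_arg z]
  constructor
  · have : 0 < ‖z‖ * (Real.sin θ * Real.cos z.arg + Real.cos θ * Real.sin z.arg) /
        (2 * Real.cos θ * Real.sin θ) := by positivity
    convert this using 1
    field_simp
  · have : 0 < ‖z‖ * (Real.sin θ * Real.cos z.arg - Real.cos θ * Real.sin z.arg) /
        (2 * Real.cos θ * Real.sin θ) := by positivity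
    convert this using 1
    field_simp

variable {X : Type*} [NormedAddCommGroup X] [NormedSpace ℂ X] {D : Set X} {A : X → X}
  {T S R : ℝ → X →L[ℂ] X}

/-- If `e^{iθ} A` and `e^{-iθ} A` generate `S` and `R`, then orbits of
`S (rayCoord θ z) (R (rayCoord (-θ) z) x)` are holomorphic for `x` in the domain of `A`. -/
lemma hasDerivAt_rays (hθ : θ ∈ Ioo 0 (π / 2))
    (hS : IsC0Semigroup S) (hSq : Quasicontractive S)
    (hSg : IsGenerator S D fun x => Complex.exp ((θ : ℂ) * I) • A x)
    (hR : IsC0Semigroup R) (hRq : Quasicontractive R)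
    (hRg : IsGenerator R D fun x => Complex.exp (-(θ : ℂ) * I) • A x)
    {x : X} (hx : x ∈ D) {z : ℂ} (hz : 0 < rayCoord θ z ∧ 0 < rayCoord (-θ) z) :
    S (rayCoord θ z) (R (rayCoord (-θ) z) x) ∈ D ∧
      HasDerivAt (fun z => S (rayCoord θ z) (R (rayCoord (-θ) z) x))
        (A (S (rayCoord θ z) (R (rayCoord (-θ) z) x))) z := by
  obtain ⟨hRx, hRA⟩ := hRg.apply_mem hR hx hz.2.le
  obtain ⟨hSx, hSA⟩ := hSg.apply_mem hS hRx hz.1.le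
  simp only [map_smul] at hRA hSA
  replace hRA := smul_right_injective X (Complex.exp_ne_zero _) hRA
  replace hSA := smul_right_injective X (Complex.exp_ne_zero _) hSA
  refine ⟨hSx, ?_⟩
  have hv : HasFDerivAt (fun z => R (rayCoord (-θ) z) x)
      ((rayCoord (-θ)).smulRight (R (rayCoord (-θ) z) (Complex.exp (-(θ : ℂ) * I) • A x))) z := by
    have := (hRg.hasDerivAt hR hRq hx hz.2).hasFDerivAt.comp z (rayCoord (-θ)).hasFDerivAt
    exact this.congr_fderiv (by ext; simp)
  have h := hSg.hasFDerivAt_comp hS hSq (rayCoord θ).hasFDerivAt hv hz.1 hRx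
  rw [hasDerivAt_iff_hasFDerivAt]
  refine hasFDerivAt_of_restrictScalars ℝ h (ContinuousLinearMap.ext fun w => ?_)
  simp only [ContinuousLinearMap.coe_restrictScalars', ContinuousLinearMap.toSpanSingleton_apply,
    add_apply, ContinuousLinearMap.smulRight_apply, map_smul, hSA, hRA]
  conv_lhs => rw [← rayCoord_decomp hθ w]
  rw [add_smul, mul_smul, mul_smul, Complex.coe_smul, Complex.coe_smul, add_comm]

/-- A semigroup whose generator has rotations by `±θ` generating semigroups extends
analytically to the sector of half-angle `θ`. -/
lemma hasAnalyticExtension_of_rotations [CompleteSpace X] (hD : Dense D)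
    (hθ : θ ∈ Ioo 0 (π / 2))
    (hT : IsC0Semigroup T) (hTq : Quasicontractive T) (hTg : IsGenerator T D A)
    (hS : IsC0Semigroup S) (hSq : Quasicontractive S)
    (hSg : IsGenerator S D fun x => Complex.exp ((θ : ℂ) * I) • A x)
    (hR : IsC0Semigroup R) (hRq : Quasicontractive R)
    (hRg : IsGenerator R D fun x => Complex.exp (-(θ : ℂ) * I) • A x) :
    HasAnalyticExtension T θ := by
  set Te : ℂ → X →L[ℂ] X := fun z => (S (rayCoord θ z)).comp (R (rayCoord (-θ) z)) with hTe
  have hc : 0 < (2 * Real.cos θ)⁻¹ :=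
    inv_pos.2 (mul_pos two_pos (Real.cos_pos_of_mem_Ioo ⟨by linarith [hθ.1, Real.pi_pos], hθ.2⟩))
  have hcoord : ∀ t : ℝ, 0 ≤ t → 0 ≤ rayCoord θ t ∧ 0 ≤ rayCoord (-θ) t := fun t ht => by
    rw [rayCoord_ofReal, rayCoord_ofReal, Real.cos_neg]
    exact ⟨by positivity, by positivity⟩
  have hcoord' : ∀ t : ℝ, 0 < t → 0 < rayCoord θ t ∧ 0 < rayCoord (-θ) t := fun t ht => by
    rw [rayCoord_ofReal, rayCoord_ofReal, Real.cos_neg]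
    exact ⟨by positivity, by positivity⟩
  have hderiv := fun {x : X} (hx : x ∈ D) {z : ℂ} hz =>
    hasDerivAt_rays (z := z) hθ hS hSq hSg hR hRq hRg hx hz
  obtain ⟨wS, hbS⟩ := hSq.exists_bound
  obtain ⟨wR, hbR⟩ := hRq.exists_bound
  have hbound : ∀ a : ℝ, ∀ z : ℂ, 0 ≤ rayCoord θ z → 0 ≤ rayCoord (-θ) z → rayCoord θ z ≤ a →
      rayCoord (-θ) z ≤ a → ‖Te z‖ ≤ Real.exp (wS * a) * Real.exp (wR * a) :=
    fun a z h1 h2 h3 h4 => (ContinuousLinearMap.opNorm_comp_le _ _).trans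
      (mul_le_mul (hbS a _ h1 h3) (hbR a _ h2 h4) (norm_nonneg _) (Real.exp_nonneg _))
  have hTe0 : Te 0 = 1 := by simp [hTe, hS.1, hR.1]; rfl
  refine ⟨Te, fun t ht => ?_, ?_, ?_⟩
  · rcases ht.eq_or_lt with rfl | ht
    · rw [Complex.ofReal_zero, hTe0, hT.1]
    refine DFunLike.coe_injective (Continuous.ext_on hD (Te t).continuous (T t).continuous
      fun x hx => ?_)
    have h := hTg.eq_apply_of_hasDerivAt (u := fun s : ℝ => Te s x) hT hTq ht ?_ ?_
    · simpa [hTe0] using h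
    · intro s hs
      have hev : ∀ᶠ i : ℝ in 𝓝[Icc 0 t] s, 0 ≤ rayCoord θ i ∧ 0 ≤ rayCoord (-θ) i := by
        filter_upwards [self_mem_nhdsWithin] with i hi using hcoord i hi.1
      have hlim : ∀ α : ℝ, Tendsto (fun i : ℝ => rayCoord α (i : ℂ)) (𝓝[Icc 0 t] s)
          (𝓝 (rayCoord α s)) := fun α =>
        ((rayCoord α).continuous.comp Complex.continuous_ofReal).continuousWithinAt
      exact hS.tendsto_apply hSq (hcoord s hs.1).1 (hlim θ) (hev.mono fun _ h => h.1)
        (hR.tendsto_apply hRq (hcoord s hs.1).2 (hlim (-θ)) (hev.mono fun _ h => h.2)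
          tendsto_const_nhds)
    · intro s hs
      obtain ⟨h1, h2⟩ := hderiv hx (hcoord' s hs.1)
      exact ⟨h1, by
        simpa [hTe, Function.comp_def] using h2.scomp s Complex.ofRealCLM.hasDerivAt⟩
  · set U : Set ℂ := {z | 0 < rayCoord θ z ∧ 0 < rayCoord (-θ) z} with hU
    have hUo : IsOpen U := (isOpen_lt continuous_const (rayCoord θ).continuous).inter
      (isOpen_lt continuous_const (rayCoord (-θ)).continuous)
    refine (differentiableOn_of_strong_differentiableOn hD hUo (fun c hc => ?_)
      fun x hx z hz => (hderiv hx hz).2.differentiableAt.differentiableWithinAt).mono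
      fun z hz => rayCoord_pos hθ hz
    have hmax := lt_add_one (max (rayCoord θ c) (rayCoord (-θ) c))
    refine ⟨Real.exp (wS * (max (rayCoord θ c) (rayCoord (-θ) c) + 1)) *
      Real.exp (wR * (max (rayCoord θ c) (rayCoord (-θ) c) + 1)), ?_⟩
    filter_upwards [hUo.mem_nhds hc,
      (rayCoord θ).continuous.continuousAt.eventually_le_const ((le_max_left _ _).trans_lt hmax),
      (rayCoord (-θ)).continuous.continuousAt.eventually_le_const
        ((le_max_right _ _).trans_lt hmax)] with z h1 h2 h3
    exact hbound _ z h1.1.le h1.2.le h2 h3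
  · refine ⟨_, fun ξ hξ hξ1 => hbound (max ‖rayCoord θ‖ ‖rayCoord (-θ)‖) ξ ?_ ?_ ?_ ?_⟩
    · by_cases h0 : ξ = 0
      · simp [h0]
      · exact (rayCoord_pos hθ ⟨hξ, h0⟩).1.le
    · by_cases h0 : ξ = 0
      · simp [h0]
      · exact (rayCoord_pos hθ ⟨hξ, h0⟩).2.le
    · exact ((Real.le_norm_self _).trans ((rayCoord θ).unit_le_opNorm ξ hξ1.le)).trans
        (le_max_left _ _)
    · exact ((Real.le_norm_self _).trans ((rayCoord (-θ)).unit_le_opNorm ξ hξ1.le)).trans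
        (le_max_right _ _)

end Rotation

/-- If a densely defined linear operator `A` on a complex Hilbert
space and its rotations `e^{±iθ}A` all generate quasicontractive `C₀`-semigroups,
then `A` generates an analytic `C₀`-semigroup on the sector `Σ_θ`. -/
theorem statement0 {H : Type*} [NormedAddCommGroup H] [InnerProductSpace ℂ H]
    [CompleteSpace H]
    (D : Submodule ℂ H) (hD : Dense (D : Set H)) (A : H →ₗ[ℂ] H)
    (θ : ℝ) (hθ : θ ∈ Set.Ioo 0 (π / 2))
    (h1 : ∃ T : ℝ → H →L[ℂ] H, IsC0Semigroup T ∧ Quasicontractive T ∧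
      IsGenerator T (D : Set H) A)
    (h2 : ∃ T : ℝ → H →L[ℂ] H, IsC0Semigroup T ∧ Quasicontractive T ∧
      IsGenerator T (D : Set H) (fun x => Complex.exp ((θ : ℂ) * Complex.I) • A x))
    (h3 : ∃ T : ℝ → H →L[ℂ] H, IsC0Semigroup T ∧ Quasicontractive T ∧
      IsGenerator T (D : Set H) (fun x => Complex.exp (-(θ : ℂ) * Complex.I) • A x)) :
    ∃ T : ℝ → H →L[ℂ] H, IsC0Semigroup T ∧ IsGenerator T (D : Set H) A ∧
      HasAnalyticExtension T θ := by
  obtain ⟨T, hT, hTq, hTg⟩ := h1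
  obtain ⟨S, hS, hSq, hSg⟩ := h2
  obtain ⟨R, hR, hRq, hRg⟩ := h3
  exact ⟨T, hT, hTg, hasAnalyticExtension_of_rotations hD hθ hT hTq hTg hS hSq hSg hR hRq hRg⟩
end

section
/- Let (T(t))_{t≥0} be a C₀-semigroup of composition operators on the weighted Hardy space H²(β), where β_n = O(√n). If T has an analytic extension to a sector Σ_θ, then T(ξ) is a composition operator for every ξ ∈ Σ_θ. -/
open Complex MeasureTheory Filter Set Metric
open scoped Real Topology ENNReal

/-- The power series of `f` converges absolutely at `z`. -/
def WSummable (β : ℕ → ℝ) (f : WH2) (z : ℂ) : Prop :=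
  Summable fun n : ℕ => (f n / (β n : ℂ)) * z ^ n

lemma wToFun_add_smul {β : ℕ → ℝ} {f g : WH2} {z : ℂ} (hf : WSummable β f z)
    (hg : WSummable β g z) (c : ℂ) :
    WSummable β (f + c • g) z ∧ wToFun β (f + c • g) z = wToFun β f z + c * wToFun β g z := by
  have h := hf.hasSum.add (hg.hasSum.mul_left c)
  have h' : HasSum (fun n : ℕ => ((f + c • g : WH2) n / (β n : ℂ)) * z ^ n)
      (wToFun β f z + c * wToFun β g z) := by
    convert h using 1
    · ext n
      simp only [lp.coeFn_add, lp.coeFn_smul, Pi.add_apply, Pi.smul_apply, smul_eq_mul]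
      ring
    · rfl
  exact ⟨h'.summable, h'.tsum_eq⟩

lemma wToFun_eq_zero_of_not_wSummable {β : ℕ → ℝ} {f : WH2} {z : ℂ} (hf : ¬ WSummable β f z) :
    wToFun β f z = 0 :=
  tsum_eq_zero_of_not_summable hf

lemma wSummable_add_smul_iff {β : ℕ → ℝ} {f g : WH2} {z : ℂ}
    (hg : WSummable β g z) (c : ℂ) : WSummable β (f + c • g) z ↔ WSummable β f z := by
  refine ⟨fun h => ?_, fun h => (wToFun_add_smul h hg c).1⟩
  have := (wToFun_add_smul h hg (-c)).1
  rwa [show f + c • g + -c • g = f by simp] at this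

lemma hasSum_eW {β : ℕ → ℝ} (hβ : ∀ n, 0 < β n) (n : ℕ) (z : ℂ) :
    HasSum (fun k : ℕ => (eW β n k / (β k : ℂ)) * z ^ k) (z ^ n) := by
  have hn : (β n : ℂ) ≠ 0 := by exact_mod_cast (hβ n).ne'
  convert hasSum_single (f := fun k : ℕ => (eW β n k / (β k : ℂ)) * z ^ k) n ?_ using 1
  · simp [eW, hn]
  · intro k hk
    simp [eW, Pi.single_eq_of_ne hk]

lemma wSummable_eW {β : ℕ → ℝ} (hβ : ∀ n, 0 < β n) (n : ℕ) (z : ℂ) : WSummable β (eW β n) z :=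
  (hasSum_eW hβ n z).summable

lemma wToFun_eW {β : ℕ → ℝ} (hβ : ∀ n, 0 < β n) (n : ℕ) (z : ℂ) :
    wToFun β (eW β n) z = z ^ n :=
  (hasSum_eW hβ n z).tsum_eq

lemma ext_eW {β : ℕ → ℝ} (hβ : ∀ n, 0 < β n) {L M : WH2 →L[ℂ] ℂ}
    (h : ∀ n, L (eW β n) = M (eW β n)) : L = M := by
  refine lp.ext_continuousLinearMap (by simp) fun n => ?_
  ext
  have hn : (β n : ℂ) ≠ 0 := by exact_mod_cast (hβ n).ne'
  have he : lp.single 2 n (1 : ℂ) = (β n : ℂ)⁻¹ • eW β n := by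
    rw [eW, ← lp.single_smul]; simp [hn]
  have h1 : L (lp.single 2 n (1 : ℂ)) = M (lp.single 2 n (1 : ℂ)) := by
    rw [he, map_smul, map_smul, h n]
  simpa using h1

lemma norm_eW {β : ℕ → ℝ} (hβ : ∀ n, 0 < β n) (n : ℕ) : ‖eW β n‖ = β n := by
  rw [eW, lp.norm_single (by simp)]
  simp [abs_of_pos (hβ n)]

lemma hasFPowerSeriesOnBall_tsum {c : ℕ → ℂ}
    (h : ∀ z ∈ uDisc, Summable fun n : ℕ => c n * z ^ n) :
    HasFPowerSeriesOnBall (fun z => ∑' n, c n * z ^ n)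
      (FormalMultilinearSeries.ofScalars ℂ c) 0 1 := by
  have hr : 1 ≤ (FormalMultilinearSeries.ofScalars ℂ c).radius := by
    refine ENNReal.le_of_forall_nnreal_lt fun r hr => ?_
    have hr' : (r : ℝ) < 1 := by exact_mod_cast hr
    refine FormalMultilinearSeries.le_radius_of_summable_norm _ ?_
    have := (h (r : ℂ) (by simpa [uDisc] using hr')).norm
    convert this using 2 with n
    simp
  have := (FormalMultilinearSeries.hasFPowerSeriesOnBall
    (FormalMultilinearSeries.ofScalars ℂ c) (by exact lt_of_lt_of_le one_pos hr)).mono one_pos hr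
  convert this using 1
  ext z
  exact (FormalMultilinearSeries.ofScalars_sum_eq c z).symm

lemma hasFPowerSeriesOnBall_wToFun {β : ℕ → ℝ} {f : WH2} (h : ∀ z ∈ uDisc, WSummable β f z) :
    HasFPowerSeriesOnBall (wToFun β f)
      (FormalMultilinearSeries.ofScalars ℂ fun n => f n / (β n : ℂ)) 0 1 :=
  hasFPowerSeriesOnBall_tsum h

lemma eball_zero_one : Metric.eball (0 : ℂ) 1 = uDisc := by
  rw [uDisc, ← Metric.eball_ofReal]; simp

lemma differentiableOn_wToFun {β : ℕ → ℝ} {f : WH2} (h : ∀ z ∈ uDisc, WSummable β f z) :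
    DifferentiableOn ℂ (wToFun β f) uDisc := by
  have := (hasFPowerSeriesOnBall_wToFun h).differentiableOn
  rwa [eball_zero_one] at this

lemma deriv_wToFun_zero {β : ℕ → ℝ} {f : WH2} (h : ∀ z ∈ uDisc, WSummable β f z) :
    deriv (wToFun β f) 0 = f 1 / (β 1 : ℂ) := by
  rw [(hasFPowerSeriesOnBall_wToFun h).hasFPowerSeriesAt.deriv]
  simp [FormalMultilinearSeries.ofScalars]

lemma coeff_eq_of_tsum_eqOn {c d : ℕ → ℂ}
    (hc : ∀ z ∈ uDisc, Summable fun n : ℕ => c n * z ^ n)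
    (hd : ∀ z ∈ uDisc, Summable fun n : ℕ => d n * z ^ n)
    (h : EqOn (fun z => ∑' n, c n * z ^ n) (fun z => ∑' n, d n * z ^ n) uDisc) : c = d := by
  have h1 := hasFPowerSeriesOnBall_tsum hc
  have h2 := hasFPowerSeriesOnBall_tsum hd
  have h3 := (h1.congr (by rwa [eball_zero_one])).hasFPowerSeriesAt.eq_formalMultilinearSeries
    h2.hasFPowerSeriesAt
  exact (FormalMultilinearSeries.ofScalars_series_eq_iff ℂ c d).1 h3

lemma sector_diff_zero_eq {θ : ℝ} (hθ : θ ∈ Set.Ioc 0 (π / 2)) :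
    Sector θ \ {0} = Complex.exp '' {w : ℂ | |w.im| < θ} := by
  have hπ := Real.pi_pos
  ext z
  constructor
  · rintro ⟨hz, hz0⟩
    refine ⟨Complex.log z, ?_, Complex.exp_log hz0⟩
    simpa [Sector, Complex.log_im] using hz
  · rintro ⟨w, hw, rfl⟩
    have hw' : |w.im| < θ := hw
    refine ⟨?_, Complex.exp_ne_zero w⟩
    have h := abs_lt.1 hw'
    rw [Sector, mem_ofPred_eq, ← Complex.log_im, Complex.log_exp (by linarith [hθ.2])
      (by linarith [hθ.2])]
    exact hw'

lemma isOpen_sector_diff_zero {θ : ℝ} (hθ : θ ∈ Set.Ioc 0 (π / 2)) :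
    IsOpen (Sector θ \ {0}) := by
  rw [sector_diff_zero_eq hθ]
  refine Complex.isOpenMap_exp _ ?_
  exact isOpen_lt (by fun_prop) continuous_const

lemma isPreconnected_sector_diff_zero {θ : ℝ} (hθ : θ ∈ Set.Ioc 0 (π / 2)) :
    IsPreconnected (Sector θ \ {0}) := by
  rw [sector_diff_zero_eq hθ]
  have hc : Convex ℝ {w : ℂ | |w.im| < θ} := by
    have : {w : ℂ | |w.im| < θ} = Complex.imLm ⁻¹' Ioo (-θ) θ := by
      ext w; simp [abs_lt]
    rw [this]
    exact (convex_Ioo _ _).linear_preimage _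
  exact hc.isPreconnected.image _ Complex.continuous_exp.continuousOn

lemma ofReal_mem_sector_diff_zero {θ : ℝ} (hθ : θ ∈ Set.Ioc 0 (π / 2)) {t : ℝ} (ht : 0 < t) :
    (t : ℂ) ∈ Sector θ \ {0} := by
  refine ⟨?_, by simpa using ht.ne'⟩
  simp [Sector, Complex.arg_ofReal_of_nonneg ht.le, hθ.1]

/-- Identity theorem: analytic functions on a sector agreeing on an initial segment of the
positive axis agree everywhere. -/
lemma eqOn_sector_of_eq_Ioo {θ : ℝ} (hθ : θ ∈ Set.Ioc 0 (π / 2)) {F G : ℂ → ℂ}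
    (hF : DifferentiableOn ℂ F (Sector θ \ {0})) (hG : DifferentiableOn ℂ G (Sector θ \ {0}))
    {δ : ℝ} (hδ : 0 < δ) (h : ∀ t : ℝ, 0 < t → t < δ → F t = G t) :
    EqOn F G (Sector θ \ {0}) := by
  have ho := isOpen_sector_diff_zero hθ
  refine (hF.analyticOnNhd ho).eqOn_of_preconnected_of_frequently_eq (hG.analyticOnNhd ho)
    (isPreconnected_sector_diff_zero hθ) (ofReal_mem_sector_diff_zero hθ (half_pos hδ)) ?_
  have ht : Tendsto (fun t : ℝ => (t : ℂ)) (𝓝[≠] (δ / 2)) (𝓝[≠] ((δ / 2 : ℝ) : ℂ)) := by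
    refine tendsto_nhdsWithin_iff.2 ⟨?_, ?_⟩
    · exact (Complex.continuous_ofReal.tendsto _).mono_left nhdsWithin_le_nhds
    · filter_upwards [self_mem_nhdsWithin] with t ht
      simpa only [mem_compl_iff, mem_singleton_iff, Complex.ofReal_inj] using ht
  have hev : ∀ᶠ t : ℝ in 𝓝[≠] (δ / 2), F t = G t := by
    have : Ioo 0 δ ∈ 𝓝 (δ / 2) := Ioo_mem_nhds (by linarith) (by linarith)
    filter_upwards [nhdsWithin_le_nhds this] with t ht using h t ht.1 ht.2
  exact ht.frequently hev.frequently

namespace RepresentsComp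

variable {β : ℕ → ℝ} {T : WH2 →L[ℂ] WH2} {φ : ℂ → ℂ}

lemma wSummable_eW_zero (hβ : ∀ n, 0 < β n) (h : RepresentsComp β T φ) {z : ℂ}
    (hz : z ∈ uDisc) : WSummable β (T (eW β 0)) z ∧ wToFun β (T (eW β 0)) z = 1 := by
  have h1 : wToFun β (T (eW β 0)) z = 1 := by rw [h.2.2 _ z hz, wToFun_eW hβ, pow_zero]
  refine ⟨?_, h1⟩
  by_contra hn
  rw [wToFun_eq_zero_of_not_wSummable hn] at h1
  exact zero_ne_one h1

/-- A composition operator preserves convergence and divergence of power series. -/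
lemma wSummable_iff (hβ : ∀ n, 0 < β n) (h : RepresentsComp β T φ) (f : WH2) {z : ℂ}
    (hz : z ∈ uDisc) : WSummable β (T f) z ↔ WSummable β f (φ z) := by
  obtain ⟨hs, hv⟩ := h.wSummable_eW_zero hβ hz
  have he := wSummable_eW hβ 0 (φ z)
  have hcomp (c : ℂ) :
      wToFun β (T f + c • T (eW β 0)) z = wToFun β (f + c • eW β 0) (φ z) := by
    rw [← map_smul, ← map_add]; exact h.2.2 _ z hz
  constructor <;> intro hf <;> by_contra hn
  · have h1 := hcomp (1 - wToFun β (T f) z)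
    rw [(wToFun_add_smul hf hs _).2, hv, wToFun_eq_zero_of_not_wSummable
      (mt (wSummable_add_smul_iff he _).1 hn)] at h1
    simp at h1
  · have h1 := hcomp (1 - wToFun β f (φ z))
    rw [(wToFun_add_smul hf he _).2, wToFun_eW hβ, wToFun_eq_zero_of_not_wSummable
      (mt (wSummable_add_smul_iff hs _).1 hn)] at h1
    simp at h1

lemma wSummable_eW (hβ : ∀ n, 0 < β n) (h : RepresentsComp β T φ) (n : ℕ) {z : ℂ}
    (hz : z ∈ uDisc) : WSummable β (T (eW β n)) z :=
  (h.wSummable_iff hβ _ hz).2 (_root_.wSummable_eW hβ n _)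

lemma wToFun_eW (hβ : ∀ n, 0 < β n) (h : RepresentsComp β T φ) (n : ℕ) {z : ℂ}
    (hz : z ∈ uDisc) : wToFun β (T (eW β n)) z = φ z ^ n := by
  rw [h.2.2 _ z hz, _root_.wToFun_eW hβ]

end RepresentsComp

/-- Point evaluations are bounded when the kernel series converges. -/
lemma exists_eval {β : ℕ → ℝ} (hβ : ∀ n, 0 < β n) {z : ℂ}
    (hs : Summable fun n : ℕ => ‖z‖ ^ n / β n) :
    ∃ L : WH2 →L[ℂ] ℂ, ∀ f, WSummable β f z ∧ wToFun β f z = L f := by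
  have hle (f : WH2) (n : ℕ) : ‖f n / (β n : ℂ) * z ^ n‖ ≤ ‖f‖ * (‖z‖ ^ n / β n) := by
    have h1 := lp.norm_apply_le_norm (p := 2) (by simp) f n
    have h2 : 0 ≤ ‖z‖ ^ n / β n := div_nonneg (by positivity) (hβ n).le
    calc ‖f n / (β n : ℂ) * z ^ n‖ = ‖f n‖ * (‖z‖ ^ n / β n) := by
          rw [norm_mul, norm_div, norm_pow, Complex.norm_real, Real.norm_of_nonneg (hβ n).le]
          ring
      _ ≤ _ := by gcongr
  have hsum (f : WH2) : WSummable β f z := .of_norm_bounded (hs.mul_left ‖f‖) (hle f)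
  refine ⟨LinearMap.mkContinuous
    { toFun := fun f => wToFun β f z
      map_add' := fun f g => ?_
      map_smul' := fun c f => ?_ } (∑' n, ‖z‖ ^ n / β n) fun f => ?_, fun f => ⟨hsum f, rfl⟩⟩
  · simpa using (wToFun_add_smul (hsum f) (hsum g) 1).2
  · have := (wToFun_add_smul (hsum 0) (hsum f) c).2
    simpa [wToFun] using this
  · change ‖wToFun β f z‖ ≤ _
    rw [mul_comm, ← tsum_mul_left]
    exact tsum_of_norm_bounded (hs.mul_left ‖f‖).hasSum (hle f)

lemma norm_le_one_of_pow_le_sqrt {w : ℂ} {C : ℝ}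
    (h : ∀ᶠ n : ℕ in atTop, ‖w‖ ^ n ≤ C * Real.sqrt n) : ‖w‖ ≤ 1 := by
  by_contra! hw
  have h1 := tendsto_pow_const_div_const_pow_of_one_lt 1 hw
  have h2 : Tendsto (fun n : ℕ => C * ((n : ℝ) ^ 1 / ‖w‖ ^ n)) atTop (𝓝 0) := by
    simpa using h1.const_mul C
  have h3 := h2.eventually (gt_mem_nhds one_pos)
  obtain ⟨n, hn, hn', hn1⟩ := (h.and (h3.and (eventually_ge_atTop 1))).exists
  have hp : 0 < ‖w‖ ^ n := by positivity
  have hn1' : (1 : ℝ) ≤ n := by exact_mod_cast hn1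
  have hsq : Real.sqrt n ≤ n := by
    rw [Real.sqrt_le_left (by positivity)]; nlinarith
  have hs0 : 0 < Real.sqrt n := Real.sqrt_pos.2 (by positivity)
  have hC : 0 ≤ C := by
    by_contra! hC
    nlinarith
  rw [pow_one, ← mul_div_assoc, div_lt_one hp] at hn'
  nlinarith

lemma isCompositionOperator_of_summable {β : ℕ → ℝ} (hβ : ∀ n, 0 < β n)
    (hO : Asymptotics.IsBigO Filter.atTop (fun n : ℕ => β n) (fun n : ℕ => Real.sqrt n))
    (hs : ∀ x : ℝ, 0 ≤ x → x < 1 → Summable fun n : ℕ => x ^ n / β n)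
    {T : ℝ → WH2 →L[ℂ] WH2} (hcomp : ∀ t : ℝ, 0 ≤ t → IsCompositionOperator β (T t))
    {θ : ℝ} (hθ : θ ∈ Set.Ioc 0 (π / 2))
    {Te : ℂ → WH2 →L[ℂ] WH2} (hext : ∀ t : ℝ, 0 ≤ t → Te t = T t)
    (hd : DifferentiableOn ℂ Te (Sector θ \ {0})) {ξ : ℂ} (hξ : ξ ∈ Sector θ \ {0}) :
    IsCompositionOperator β (Te ξ) := by
  have hz (z : ℂ) (hz : z ∈ uDisc) : ‖z‖ < 1 := by simpa [uDisc] using hz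
  have hev (z : ℂ) (h : z ∈ uDisc) := exists_eval hβ (hs ‖z‖ (norm_nonneg z) (hz z h))
  have hdiff (z : ℂ) (h : z ∈ uDisc) (f : WH2) :
      DifferentiableOn ℂ (fun ξ => wToFun β (Te ξ f) z) (Sector θ \ {0}) := by
    obtain ⟨L, hL⟩ := hev z h
    simp only [(hL _).2]
    exact L.differentiable.comp_differentiableOn (hd.clm_apply (differentiableOn_const f))
  have hpow (n : ℕ) (z : ℂ) (h : z ∈ uDisc) : EqOn (fun ξ => wToFun β (Te ξ (eW β n)) z)
      (fun ξ => wToFun β (Te ξ (eW β 1)) z ^ n) (Sector θ \ {0}) := by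
    refine eqOn_sector_of_eq_Ioo hθ (hdiff z h _) ((hdiff z h _).pow n) one_pos
      fun t ht _ => ?_
    obtain ⟨φ, hφ⟩ := hcomp t ht.le
    simp only [hext t ht.le, hφ.wToFun_eW hβ _ h, pow_one]
  have hle (z : ℂ) (h : z ∈ uDisc) (η : ℂ) (hη : η ∈ Sector θ \ {0}) :
      ‖wToFun β (Te η (eW β 1)) z‖ ≤ 1 := by
    obtain ⟨L, hL⟩ := hev z h
    obtain ⟨C, hC⟩ := hO.bound
    refine norm_le_one_of_pow_le_sqrt (C := ‖L‖ * ‖Te η‖ * C) ?_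
    filter_upwards [hC] with n hn
    rw [Real.norm_of_nonneg (hβ n).le, Real.norm_of_nonneg (Real.sqrt_nonneg _)] at hn
    have h1 := hpow n z h hη
    simp only at h1
    rw [← norm_pow, ← h1, (hL _).2]
    calc ‖L (Te η (eW β n))‖ ≤ ‖L‖ * (‖Te η‖ * ‖eW β n‖) :=
          (L.le_opNorm _).trans (by gcongr; exact (Te η).le_opNorm _)
      _ ≤ ‖L‖ * (‖Te η‖ * (C * Real.sqrt n)) := by rw [norm_eW hβ]; gcongr
      _ = _ := by ring
  have hlt (z : ℂ) (h : z ∈ uDisc) : ‖wToFun β (Te ξ (eW β 1)) z‖ < 1 := by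
    refine lt_of_le_of_ne (hle z h ξ hξ) fun heq => ?_
    have hone : (1 : ℂ) ∈ Sector θ \ {0} := by
      simpa using ofReal_mem_sector_diff_zero hθ one_pos
    have hmax := Complex.eqOn_of_isPreconnected_of_isMaxOn_norm
      (isPreconnected_sector_diff_zero hθ) (isOpen_sector_diff_zero hθ) (hdiff z h (eW β 1)) hξ
      (fun η hη => by simpa [heq] using hle z h η hη) hone
    obtain ⟨φ, hφ⟩ := hcomp 1 zero_le_one
    have h1 : wToFun β (Te 1 (eW β 1)) z = φ z := by
      have := hext 1 zero_le_one
      rw [Complex.ofReal_one] at this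
      rw [this, hφ.wToFun_eW hβ 1 h, pow_one]
    simp only [Function.const_apply, h1] at hmax
    have := hz _ (hφ.2.1 h)
    rw [hmax, heq] at this
    exact lt_irrefl _ this
  refine ⟨wToFun β (Te ξ (eW β 1)), differentiableOn_wToFun fun z h => ?_,
    fun z h => by simpa [uDisc] using hlt z h, fun f z h => ?_⟩
  · obtain ⟨L, hL⟩ := hev z h
    exact (hL _).1
  · obtain ⟨L, hL⟩ := hev z h
    obtain ⟨M, hM⟩ := hev (wToFun β (Te ξ (eW β 1)) z) (by simpa [uDisc] using hlt z h)
    have : L.comp (Te ξ) = M := by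
      refine ext_eW hβ fun n => ?_
      rw [ContinuousLinearMap.comp_apply, ← (hL _).2, ← (hM _).2, wToFun_eW hβ]
      exact hpow n z h hξ
    rw [(hL _).2, (hM _).2, ← this, ContinuousLinearMap.comp_apply]

lemma wSummable_iff_norm {β : ℕ → ℝ} (hβ : ∀ n, 0 < β n) {f : WH2} {z : ℂ} :
    WSummable β f z ↔ Summable fun n : ℕ => ‖f n‖ / β n * ‖z‖ ^ n := by
  rw [WSummable, ← summable_norm_iff]
  simp [abs_of_pos (hβ _)]

lemma WSummable.of_norm_le {β : ℕ → ℝ} (hβ : ∀ n, 0 < β n) {f : WH2} {z w : ℂ}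
    (hf : WSummable β f z) (h : ‖w‖ ≤ ‖z‖) : WSummable β f w := by
  rw [wSummable_iff_norm hβ] at *
  refine hf.of_nonneg_of_le
    (fun n => mul_nonneg (div_nonneg (norm_nonneg _) (hβ n).le) (by positivity)) fun n => ?_
  have := div_nonneg (norm_nonneg (f n)) (hβ n).le
  gcongr

/-- Outside the disc of convergence of `∑ xⁿ / βₙ`, elements of `H²(β)` separate radii by
convergence of their power series. -/
lemma exists_wSummable_not_wSummable {β : ℕ → ℝ} (hβ : ∀ n, 0 < β n) {x₀ : ℝ} (hx₀ : 0 ≤ x₀)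
    (hns : ¬ Summable fun n : ℕ => x₀ ^ n / β n) {z w : ℂ} (hzw : ‖z‖ < ‖w‖) (hw : x₀ < ‖w‖) :
    ∃ f : WH2, WSummable β f z ∧ ¬ WSummable β f w := by
  have hw0 : 0 < ‖w‖ := hx₀.trans_lt hw
  obtain ⟨u, hzu, huw⟩ := exists_between hzw
  have hu0 : 0 < u := (norm_nonneg z).trans_lt hzu
  obtain ⟨v, hxv, hv1⟩ := exists_between ((div_lt_one hw0).2 hw)
  have hv0 : 0 < v := (div_nonneg hx₀ hw0.le).trans_lt hxv
  have hxvw : x₀ < v * ‖w‖ := (div_lt_iff₀ hw0).1 hxv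
  have hvw0 : 0 < v * ‖w‖ := by positivity
  let a : ℕ → ℝ := fun n => min (β n / u ^ n) (v ^ n)
  have ha0 (n : ℕ) : 0 < a n := lt_min (div_pos (hβ n) (by positivity)) (by positivity)
  have hmem : Memℓp (fun n : ℕ => (a n : ℂ)) 2 := by
    refine memℓp_gen ?_
    have hg : Summable fun n : ℕ => (v ^ 2) ^ n :=
      summable_geometric_of_lt_one (by positivity) (by nlinarith)
    refine hg.of_nonneg_of_le (fun n => by positivity) fun n => ?_
    rw [Complex.norm_real, Real.norm_of_nonneg (ha0 n).le, ← pow_mul, mul_comm, pow_mul]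
    have : a n ≤ v ^ n := min_le_right _ _
    have h0 := (ha0 n).le
    simp only [ENNReal.toReal_ofNat, Real.rpow_ofNat]
    gcongr
  have hnorm (n : ℕ) : ‖(⟨_, hmem⟩ : WH2) n‖ = a n := by
    change ‖(a n : ℂ)‖ = a n
    rw [Complex.norm_real, Real.norm_of_nonneg (ha0 n).le]
  refine ⟨⟨_, hmem⟩, ?_, fun hsum => hns ?_⟩
  · rw [wSummable_iff_norm hβ]
    simp only [hnorm]
    have hg : Summable fun n : ℕ => (‖z‖ / u) ^ n :=
      summable_geometric_of_lt_one (by positivity) ((div_lt_one hu0).2 hzu)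
    refine hg.of_nonneg_of_le (fun n => mul_nonneg (div_nonneg (ha0 n).le (hβ n).le)
      (by positivity)) fun n => ?_
    have : a n / β n ≤ 1 / u ^ n := by
      rw [div_le_iff₀ (hβ n), one_div_mul_eq_div]; exact min_le_left _ _
    calc a n / β n * ‖z‖ ^ n ≤ 1 / u ^ n * ‖z‖ ^ n := by gcongr
      _ = (‖z‖ / u) ^ n := by rw [div_pow]; ring
  · rw [wSummable_iff_norm hβ] at hsum
    simp only [hnorm] at hsum
    have hev := hsum.tendsto_atTop_zero.eventually (gt_mem_nhds one_pos)
    have hg : Summable fun n : ℕ => (x₀ / (v * ‖w‖)) ^ n :=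
      summable_geometric_of_lt_one (by positivity) ((div_lt_one hvw0).2 hxvw)
    refine hg.of_norm_bounded_eventually_nat ?_
    filter_upwards [hev] with n hn
    have hb := hβ n
    rw [Real.norm_of_nonneg (div_nonneg (by positivity) hb.le)]
    have hlt : (v * ‖w‖) ^ n < β n := by
      rw [div_mul_eq_mul_div, div_lt_one hb] at hn
      rcases min_choice (β n / u ^ n) (v ^ n) with h | h
      · exfalso
        have h1 : β n / u ^ n * ‖w‖ ^ n < β n := by simpa only [a, h] using hn
        have h2 : u ^ n ≤ ‖w‖ ^ n := by gcongr
        rw [div_mul_eq_mul_div, div_lt_iff₀ (by positivity)] at h1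
        nlinarith
      · rw [mul_pow]
        simpa only [a, h] using hn
    rw [div_pow]
    have := pow_pos hvw0 n
    gcongr

/-- If `H²(β)` contains power series diverging inside the disc, then the symbol of a composition
operator which takes values of large modulus and has nonzero derivative at the origin is linear. -/
lemma RepresentsComp.eq_mul {β : ℕ → ℝ} (hβ : ∀ n, 0 < β n) {x₀ : ℝ} (hx₀ : 0 ≤ x₀)
    (hns : ¬ Summable fun n : ℕ => x₀ ^ n / β n) {T : WH2 →L[ℂ] WH2} {φ : ℂ → ℂ}
    (h : RepresentsComp β T φ) {z₀ : ℂ} (hz₀ : z₀ ∈ uDisc) (hφ : x₀ < ‖φ z₀‖)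
    (h1 : T (eW β 1) 1 ≠ 0) : ∀ z ∈ uDisc, φ z = T (eW β 1) 1 / (β 1 : ℂ) * z := by
  have hmem {z : ℂ} : z ∈ uDisc ↔ ‖z‖ < 1 := by simp [uDisc]
  have ho : IsOpen uDisc := isOpen_ball
  have hrad (z w : ℂ) (hz : z ∈ uDisc) (hzw : ‖z‖ = ‖w‖) (hx : x₀ < ‖φ z‖) :
      ‖φ z‖ ≤ ‖φ w‖ := by
    by_contra! hlt
    obtain ⟨f, hf1, hf2⟩ := exists_wSummable_not_wSummable hβ hx₀ hns hlt hx
    have hw : w ∈ uDisc := hmem.2 (hzw ▸ hmem.1 hz)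
    rw [← h.wSummable_iff hβ f hw] at hf1
    rw [← h.wSummable_iff hβ f hz] at hf2
    exact hf2 (hf1.of_norm_le hβ hzw.le)
  set c : ℕ → ℂ := fun n => T (eW β 1) n / (β n : ℂ) with hc
  have hsum (z : ℂ) (hz : z ∈ uDisc) : Summable fun n => c n * z ^ n := h.wSummable_eW hβ 1 hz
  have hval (z : ℂ) (hz : z ∈ uDisc) : ∑' n, c n * z ^ n = φ z := by
    simpa [wToFun] using h.wToFun_eW hβ 1 hz
  have hrot (l : ℂ) (hl : ‖l‖ = 1) : ∃ μ : ℂ, ∀ n, c n * l ^ n = μ * c n := by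
    have hmaps : MapsTo (fun z => l * z) uDisc uDisc := fun z hz => by
      rw [hmem] at *; simpa [hl] using hz
    have hdl : DifferentiableOn ℂ (fun z => φ (l * z)) uDisc :=
      h.1.comp (by fun_prop) hmaps
    have hU : ∀ᶠ z in 𝓝 z₀, z ∈ uDisc ∧ x₀ < ‖φ z‖ :=
      (ho.eventually_mem hz₀).and ((h.1.continuousOn.continuousAt (ho.mem_nhds hz₀)).norm.eventually
        (lt_mem_nhds hφ))
    have hne (z : ℂ) (hz : x₀ < ‖φ z‖) : φ z ≠ 0 := norm_pos_iff.1 (hx₀.trans_lt hz)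
    have hone (z : ℂ) (hz : z ∈ uDisc) (hx : x₀ < ‖φ z‖) : ‖φ (l * z) / φ z‖ = 1 := by
      have e1 : ‖z‖ = ‖l * z‖ := by simp [hl]
      have e2 := hrad z (l * z) hz e1 hx
      have e3 := hrad (l * z) z (hmaps hz) e1.symm (hx.trans_le e2)
      rw [norm_div, le_antisymm e3 e2, div_self (norm_ne_zero_iff.2 (hne z hx))]
    have hloc := Complex.eventually_eq_of_isLocalMax_norm (f := fun z => φ (l * z) / φ z)
      (c := z₀) (by
        filter_upwards [hU] with z hz
        exact (hdl.differentiableAt (ho.mem_nhds hz.1)).div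
          (h.1.differentiableAt (ho.mem_nhds hz.1)) (hne z hz.2)) (by
        filter_upwards [hU] with z hz
        simp only [Function.comp_apply]
        rw [hone z hz.1 hz.2, hone z₀ hz₀ hφ])
    refine ⟨φ (l * z₀) / φ z₀, ?_⟩
    set μ := φ (l * z₀) / φ z₀
    have heq : EqOn (fun z => φ (l * z)) (fun z => μ * φ z) uDisc := by
      refine (hdl.analyticOnNhd ho).eqOn_of_preconnected_of_eventuallyEq
        ((h.1.const_mul μ).analyticOnNhd ho) (convex_ball _ _).isPreconnected hz₀ ?_
      filter_upwards [hloc, hU] with z hz hz'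
      rw [← hz, div_mul_cancel₀ _ (hne z hz'.2)]
    refine congrFun (coeff_eq_of_tsum_eqOn (c := fun n => c n * l ^ n) (d := fun n => μ * c n)
      (fun z hz => ?_) (fun z hz => ?_) fun z hz => ?_)
    · simpa only [mul_pow, mul_assoc] using hsum _ (hmaps hz)
    · simpa only [mul_assoc] using (hsum z hz).mul_left μ
    · simp only [mul_assoc, ← mul_pow, tsum_mul_left]
      rw [hval z hz, hval _ (hmaps hz)]
      exact heq hz
  have hc1 : c 1 ≠ 0 := div_ne_zero h1 (by exact_mod_cast (hβ 1).ne')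
  have hc0 (n : ℕ) (hn : n ≠ 1) : c n = 0 := by
    have hn' : (n : ℂ) - 1 ≠ 0 := sub_ne_zero.2 (by exact_mod_cast hn)
    set l : ℂ := Complex.exp (((π / ((n : ℝ) - 1) : ℝ) : ℂ) * Complex.I) with hl
    have hpow : l ^ n = -l := by
      rw [hl, ← Complex.exp_nat_mul, ← neg_one_mul, ← Complex.exp_pi_mul_I, ← Complex.exp_add]
      congr 1
      push_cast
      field_simp
      ring
    obtain ⟨μ, hμ⟩ := hrot l (Complex.norm_exp_ofReal_mul_I _)
    have e1 : μ = l := by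
      have := hμ 1
      rw [pow_one, mul_comm] at this
      exact (mul_right_cancel₀ hc1 this).symm
    have e2 := hμ n
    rw [hpow, e1] at e2
    have e3 : (2 * l) * c n = 0 := by linear_combination -e2
    exact (mul_eq_zero.1 e3).resolve_left (mul_ne_zero two_ne_zero (Complex.exp_ne_zero _))
  intro z hz
  rw [← hval z hz, tsum_eq_single 1 fun n hn => by rw [hc0 n hn, zero_mul], pow_one]

lemma RepresentsComp.apply_eW_of_eq_mul {β : ℕ → ℝ} (hβ : ∀ n, 0 < β n) {T : WH2 →L[ℂ] WH2}
    {φ : ℂ → ℂ} (h : RepresentsComp β T φ) {c : ℂ} (hc : ∀ z ∈ uDisc, φ z = c * z) (n : ℕ) :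
    T (eW β n) = c ^ n • eW β n := by
  have h1 := coeff_eq_of_tsum_eqOn (fun z hz => h.wSummable_eW hβ n hz)
    (d := fun k => c ^ n * (eW β n k / (β k : ℂ)))
    (fun z _ => by simpa only [mul_assoc] using (_root_.wSummable_eW hβ n z).mul_left (c ^ n))
    (fun z hz => by
      have e1 := h.wToFun_eW hβ n hz
      have e2 := _root_.wToFun_eW hβ n z
      simp only [wToFun] at e1 e2
      simp only [mul_assoc, tsum_mul_left]
      rw [e1, e2, hc z hz, mul_pow])
  ext k
  have h2 := congrFun h1 k
  have hk : (β k : ℂ) ≠ 0 := by exact_mod_cast (hβ k).ne'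
  simp only [lp.coeFn_smul, Pi.smul_apply, smul_eq_mul]
  rw [← mul_div_assoc] at h2
  exact (div_left_inj' hk).1 h2

lemma isCompositionOperator_of_not_summable {β : ℕ → ℝ} (hβ : ∀ n, 0 < β n)
    {x₀ : ℝ} (hx₀ : 0 ≤ x₀) (hx₁ : x₀ < 1)
    (hns : ¬ Summable fun n : ℕ => x₀ ^ n / β n)
    {T : ℝ → WH2 →L[ℂ] WH2} (hT : IsC0Semigroup T)
    (hcomp : ∀ t : ℝ, 0 ≤ t → IsCompositionOperator β (T t))
    {θ : ℝ} (hθ : θ ∈ Set.Ioc 0 (π / 2))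
    {Te : ℂ → WH2 →L[ℂ] WH2} (hext : ∀ t : ℝ, 0 ≤ t → Te t = T t)
    (hd : DifferentiableOn ℂ Te (Sector θ \ {0})) {ξ : ℂ} (hξ : ξ ∈ Sector θ \ {0}) :
    IsCompositionOperator β (Te ξ) := by
  have hβ1 : (β 1 : ℂ) ≠ 0 := by exact_mod_cast (hβ 1).ne'
  obtain ⟨r, hxr, hr1⟩ := exists_between hx₁
  have hr0 : 0 < r := hx₀.trans_lt hxr
  have htend : Tendsto (fun t : ℝ => T t (eW β 1) 1 / (β 1 : ℂ)) (𝓝[≥] 0) (𝓝 1) := by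
    have e := (((lp.evalCLM ℂ (fun _ : ℕ => ℂ) 2 1).continuous.tendsto _).comp
      (hT.2.2 (eW β 1))).div_const (β 1 : ℂ)
    have e1 : lp.evalCLM ℂ (fun _ : ℕ => ℂ) 2 1 (eW β 1) / (β 1 : ℂ) = 1 := by
      change eW β 1 1 / (β 1 : ℂ) = 1
      simp [eW, hβ1]
    rw [e1] at e
    exact e
  have hlarge : ∀ᶠ t : ℝ in 𝓝[≥] 0, x₀ / r < ‖T t (eW β 1) 1 / (β 1 : ℂ)‖ := by
    refine htend.norm.eventually (lt_mem_nhds ?_)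
    rwa [norm_one, div_lt_one hr0]
  obtain ⟨δ, hδ, hδ'⟩ := (mem_nhdsGE_iff_exists_Ico_subset).1 hlarge
  have hsmall (t : ℝ) (ht : 0 < t) (htδ : t < δ) (n : ℕ) :
      T t (eW β n) = (T t (eW β 1) 1 / (β 1 : ℂ)) ^ n • eW β n := by
    obtain ⟨φ, hφ⟩ := hcomp t ht.le
    have hlt : x₀ / r < ‖T t (eW β 1) 1 / (β 1 : ℂ)‖ := hδ' ⟨ht.le, htδ⟩
    have hne : T t (eW β 1) 1 / (β 1 : ℂ) ≠ 0 :=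
      norm_pos_iff.1 ((div_nonneg hx₀ hr0.le).trans_lt hlt)
    obtain ⟨z₀, hz₀, hz₀'⟩ : ∃ z₀ ∈ uDisc, x₀ < ‖φ z₀‖ := by
      by_contra! hall
      have hsum : ∀ z ∈ uDisc, WSummable β (T t (eW β 1)) z :=
        fun z hz => hφ.wSummable_eW hβ 1 hz
      have hsub : closedBall (0 : ℂ) r ⊆ uDisc := closedBall_subset_ball hr1
      have hdc : DiffContOnCl ℂ (wToFun β (T t (eW β 1))) (ball 0 r) := by
        refine ((differentiableOn_wToFun hsum).mono ?_).diffContOnCl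
        rwa [closure_ball _ hr0.ne']
      have hder := Complex.norm_deriv_le_of_forall_mem_sphere_norm_le hr0 hdc
        (C := x₀) fun z hz => by
          have hz' := hsub (sphere_subset_closedBall hz)
          rw [hφ.wToFun_eW hβ 1 hz', pow_one]
          exact hall z hz'
      rw [deriv_wToFun_zero hsum] at hder
      exact hder.not_gt hlt
    exact hφ.apply_eW_of_eq_mul hβ
      (hφ.eq_mul hβ hx₀ hns hz₀ hz₀' fun h0 => hne (by rw [h0, zero_div])) n
  have hcoord (f : WH2) (k : ℕ) :
      DifferentiableOn ℂ (fun η => Te η f k) (Sector θ \ {0}) :=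
    (lp.evalCLM ℂ (fun _ : ℕ => ℂ) 2 k).differentiable.comp_differentiableOn
      (hd.clm_apply (differentiableOn_const f))
  set c : ℂ := Te ξ (eW β 1) 1 / (β 1 : ℂ) with hc
  have hdiag (n : ℕ) : Te ξ (eW β n) = c ^ n • eW β n := by
    ext k
    refine eqOn_sector_of_eq_Ioo hθ (hcoord (eW β n) k)
      (G := fun η => (Te η (eW β 1) 1 / (β 1 : ℂ)) ^ n * eW β n k)
      ((((hcoord (eW β 1) 1).div_const _).pow n).mul_const _) hδ (fun t ht htδ => ?_) hξ
    have := congrArg (fun f : WH2 => f k) (hsmall t ht htδ n)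
    simpa only [hext t ht.le, lp.coeFn_smul, Pi.smul_apply, smul_eq_mul] using this
  have hcle : ‖c‖ ≤ 1 := by
    by_contra! hc1
    obtain ⟨n, hn⟩ := pow_unbounded_of_one_lt ‖Te ξ‖ hc1
    have := (Te ξ).le_opNorm (eW β n)
    rw [hdiag, norm_smul, norm_pow, norm_eW hβ] at this
    exact hn.not_ge (le_of_mul_le_mul_right this (hβ n))
  have happly (f : WH2) (k : ℕ) : Te ξ f k = c ^ k * f k := by
    have : (lp.evalCLM ℂ (fun _ : ℕ => ℂ) 2 k).comp (Te ξ) =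
        c ^ k • lp.evalCLM ℂ (fun _ : ℕ => ℂ) 2 k := by
      refine ext_eW hβ fun n => ?_
      change Te ξ (eW β n) k = c ^ k * eW β n k
      rw [hdiag]
      rcases eq_or_ne k n with rfl | hkn
      · rfl
      · simp [eW, Pi.single_eq_of_ne hkn]
    exact congrArg (fun L : WH2 →L[ℂ] ℂ => L f) this
  refine ⟨fun z => c * z, by fun_prop, fun z hz => ?_, fun f z _ => ?_⟩
  · simp only [uDisc, mem_ball_zero_iff, norm_mul] at *
    nlinarith [norm_nonneg z]
  · refine tsum_congr fun n => ?_
    rw [happly, mul_pow]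
    ring

/-- If a `C₀`-semigroup of composition operators on `H²(β)`, where
`βₙ = O(√n)`, has an analytic extension to a sector `Σ_θ`, then every operator of
the extension is a composition operator. -/
theorem statement2 (β : ℕ → ℝ) (hβ : ∀ n, 0 < β n)
    (hO : Asymptotics.IsBigO Filter.atTop (fun n : ℕ => β n) (fun n : ℕ => Real.sqrt n))
    (T : ℝ → WH2 →L[ℂ] WH2) (hT : IsC0Semigroup T)
    (hcomp : ∀ t : ℝ, 0 ≤ t → IsCompositionOperator β (T t))
    (θ : ℝ) (hθ : θ ∈ Set.Ioc 0 (π / 2))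
    (Te : ℂ → WH2 →L[ℂ] WH2) (hTe : IsAnalyticExtension T θ Te) :
    ∀ ξ ∈ Sector θ, IsCompositionOperator β (Te ξ) := by
  obtain ⟨hext, hd, -⟩ := hTe
  intro ξ hξ
  rcases eq_or_ne ξ 0 with rfl | hξ0
  · have := hext 0 le_rfl
    rw [Complex.ofReal_zero] at this
    exact this ▸ hcomp 0 le_rfl
  by_cases hs : ∀ x : ℝ, 0 ≤ x → x < 1 → Summable fun n : ℕ => x ^ n / β n
  · exact isCompositionOperator_of_summable hβ hO hs hcomp hθ hext hd ⟨hξ, hξ0⟩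
  · push Not at hs
    obtain ⟨x₀, hx₀, hx₁, hns⟩ := hs
    exact isCompositionOperator_of_not_summable hβ hx₀ hx₁ hns hT hcomp hθ hext hd ⟨hξ, hξ0⟩
end

section
/- Let T : H²(𝔻) → H²(𝔻) be a bounded linear operator with Te₀ not identically zero and Te₀ ∈ H^∞(𝔻). Then T is a weighted composition operator (i.e. Tf = w·(f∘φ) for some w and some analytic φ : 𝔻 → 𝔻) if and only if (Te₀)^{n-1} Te_n = (Te₁)ⁿ for all positive integers n, where e_n(z) = zⁿ. -/
open Complex MeasureTheory Filter Set Metric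
open scoped Real Topology ENNReal

theorem wToFun_hardyW (f : WH2) (z : ℂ) : wToFun hardyW f z = ∑' n : ℕ, f n * z ^ n := by
  simp [wToFun, hardyW]

theorem wToFun_hardyW_eW (n : ℕ) (z : ℂ) : wToFun hardyW (eW hardyW n) z = z ^ n := by
  rw [wToFun_hardyW, tsum_eq_single n]
  · simp [eW, hardyW]
  · intro m hm
    simp [eW, hardyW, lp.single_apply, hm]

theorem differentiableOn_wToFun_hardyW (f : WH2) :
    DifferentiableOn ℂ (wToFun hardyW f) uDisc := by
  intro z hz
  obtain ⟨r, hzr, hr1⟩ := exists_between (mem_ball_zero_iff.mp hz)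
  have hr0 : 0 ≤ r := (norm_nonneg z).trans hzr.le
  have hd : DifferentiableOn ℂ (fun z : ℂ => ∑' n : ℕ, f n * z ^ n) (ball 0 r) := by
    refine differentiableOn_tsum_of_summable_norm (u := fun n => ‖f‖ * r ^ n)
      ((summable_geometric_of_lt_one hr0 hr1).mul_left _) (fun n => by fun_prop) isOpen_ball ?_
    intro n x hx
    rw [norm_mul, norm_pow]
    gcongr
    · exact lp.norm_apply_le_norm (by norm_num) f n
    · exact (mem_ball_zero_iff.mp hx).le
  have hfun : wToFun hardyW f = fun z : ℂ => ∑' n : ℕ, f n * z ^ n :=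
    funext (wToFun_hardyW f)
  rw [hfun]
  exact (hd.differentiableAt
    (isOpen_ball.mem_nhds (mem_ball_zero_iff.mpr hzr))).differentiableWithinAt

/-- Point evaluations on `H²(𝔻)` are bounded linear functionals. -/
theorem exists_clm_eq_wToFun_hardyW {z : ℂ} (hz : z ∈ uDisc) :
    ∃ E : WH2 →L[ℂ] ℂ, ∀ f, E f = wToFun hardyW f z := by
  have hz1 : ‖z‖ < 1 := mem_ball_zero_iff.mp hz
  have hk : Memℓp (fun n : ℕ => (starRingEnd ℂ) (z ^ n)) 2 := by
    refine memℓp_gen ?_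
    have hs : Summable fun n : ℕ => (‖z‖ ^ 2) ^ n :=
      summable_geometric_of_lt_one (by positivity) (by nlinarith [norm_nonneg z])
    refine hs.congr fun n => ?_
    simp [← pow_mul, mul_comm]
  refine ⟨innerSL ℂ (⟨_, hk⟩ : WH2), fun f => ?_⟩
  rw [innerSL_apply_apply, lp.inner_eq_tsum, wToFun_hardyW]
  refine tsum_congr fun n => ?_
  simp

theorem hasSum_clm_eW (L : WH2 →L[ℂ] ℂ) (f : WH2) :
    HasSum (fun n : ℕ => f n * L (eW hardyW n)) (L f) := by
  have h := L.hasSum (lp.hasSum_single (by norm_num) f)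
  refine h.congr_fun fun n => ?_
  rw [← smul_eq_mul, ← map_smul, eW, ← lp.single_smul]
  simp [hardyW]

theorem tendsto_clm_eW (L : WH2 →L[ℂ] ℂ) :
    Tendsto (fun n : ℕ => ‖L (eW hardyW n)‖) atTop (𝓝 0) := by
  set y : WH2 := (InnerProductSpace.toDual ℂ WH2).symm L with hy
  have hL : ∀ n, ‖L (eW hardyW n)‖ = ‖y n‖ := by
    intro n
    rw [← InnerProductSpace.toDual_symm_apply (y := L), eW, lp.inner_single_right]
    simp [hardyW, hy]
  have hs := ((lp.memℓp y).summable (by norm_num)).tendsto_atTop_zero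
  simp only [hL]
  have := hs.sqrt
  simpa using this

/-- Removable singularities: a quotient of holomorphic functions whose modulus is less than one
wherever the denominator does not vanish extends to a holomorphic map into the disc. -/
theorem exists_extension_div {U : Set ℂ} (hU : IsOpen U) {w g : ℂ → ℂ}
    (hw : DifferentiableOn ℂ w U) (hg : DifferentiableOn ℂ g U)
    (hne : ∀ c ∈ U, ∀ᶠ z in 𝓝[≠] c, w z ≠ 0)
    (hlt : ∀ z ∈ U, w z ≠ 0 → ‖g z / w z‖ < 1) :
    ∃ φ : ℂ → ℂ, DifferentiableOn ℂ φ U ∧ MapsTo φ U uDisc ∧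
      ∀ z ∈ U, w z ≠ 0 → φ z = g z / w z := by
  set q : ℂ → ℂ := fun z => g z / w z with hq
  have hqd : ∀ z ∈ U, w z ≠ 0 → DifferentiableAt ℂ q z := fun z hz hwz =>
    (hg.differentiableAt (hU.mem_nhds hz)).div (hw.differentiableAt (hU.mem_nhds hz)) hwz
  set φ : ℂ → ℂ := fun c => limUnder (𝓝[≠] c) q with hφ
  have hφq : ∀ z ∈ U, w z ≠ 0 → φ z = q z := fun z hz hwz =>
    ((hqd z hz hwz).continuousAt.tendsto.mono_left nhdsWithin_le_nhds).limUnder_eq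
  have hφd : DifferentiableOn ℂ φ U := by
    intro c hc
    have hev : ∀ᶠ z in 𝓝 c, z ∈ U ∧ (z ≠ c → w z ≠ 0) :=
      Filter.Eventually.and (hU.mem_nhds hc) (eventually_nhdsWithin_iff.mp (hne c hc))
    obtain ⟨s, hs, hso, hcs⟩ := _root_.eventually_nhds_iff.mp hev
    have hsn : s ∈ 𝓝 c := hso.mem_nhds hcs
    have hupd : DifferentiableOn ℂ (Function.update q c (limUnder (𝓝[≠] c) q)) s := by
      refine differentiableOn_update_limUnder_of_bddAbove hsn ?_ ⟨1, ?_⟩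
      · exact fun z hz => (hqd z (hs z hz.1).1 ((hs z hz.1).2 hz.2)).differentiableWithinAt
      · rintro _ ⟨z, hz, rfl⟩
        exact (hlt z (hs z hz.1).1 ((hs z hz.1).2 hz.2)).le
    have heq : φ =ᶠ[𝓝 c] Function.update q c (limUnder (𝓝[≠] c) q) := by
      filter_upwards [hsn] with z hz
      by_cases h : z = c
      · subst h; simp [hφ]
      · rw [Function.update_of_ne h, hφq z (hs z hz).1 ((hs z hz).2 h)]
    exact (heq.differentiableAt_iff.mpr (hupd.differentiableAt hsn)).differentiableWithinAt
  refine ⟨φ, hφd, fun c hc => ?_, hφq⟩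
  rw [uDisc, mem_ball_zero_iff]
  by_contra! hge
  have hev : ∀ᶠ z in 𝓝[≠] c, ‖φ z‖ < 1 := by
    filter_upwards [hne c hc, nhdsWithin_le_nhds (hU.mem_nhds hc)] with z hwz hz
    rw [hφq z hz hwz]
    exact hlt z hz hwz
  have hmax : IsLocalMax (norm ∘ φ) c := by
    filter_upwards [eventually_nhdsWithin_iff.mp hev] with z hz
    by_cases h : z = c
    · rw [h]
    · exact (hz h).le.trans hge
  have hconst := eventually_eq_of_isLocalMax_norm
    (by filter_upwards [hU.mem_nhds hc] with z hz using hφd.differentiableAt (hU.mem_nhds hz)) hmax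
  obtain ⟨z, hz1, hz2⟩ := (hev.and (nhdsWithin_le_nhds hconst)).exists
  rw [hz2] at hz1
  exact hz1.not_ge hge

theorem isWeightedCompOp_of_pow_mul_eq (T : WH2 →L[ℂ] WH2)
    (hne : ∃ z ∈ uDisc, wToFun hardyW (T (eW hardyW 0)) z ≠ 0)
    (hT : ∀ n : ℕ, 1 ≤ n → ∀ z ∈ uDisc,
        (wToFun hardyW (T (eW hardyW 0)) z) ^ (n - 1) *
            wToFun hardyW (T (eW hardyW n)) z =
          (wToFun hardyW (T (eW hardyW 1)) z) ^ n) :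
    IsWeightedCompOp T := by
  set w := wToFun hardyW (T (eW hardyW 0)) with hw
  set g := wToFun hardyW (T (eW hardyW 1)) with hg
  have hU : IsOpen uDisc := isOpen_ball
  have hwd : DifferentiableOn ℂ w uDisc := differentiableOn_wToFun_hardyW _
  have hgd : DifferentiableOn ℂ g uDisc := differentiableOn_wToFun_hardyW _
  have hTn : ∀ z ∈ uDisc, w z ≠ 0 → ∀ n,
      wToFun hardyW (T (eW hardyW n)) z = w z * (g z / w z) ^ n := by
    intro z hz hwz n
    rcases n with _ | n
    · simp [hw]
    · have h := hT (n + 1) (by omega) z hz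
      rw [Nat.add_sub_cancel] at h
      rw [div_pow, ← h]
      field_simp
      ring
  have hwne : ∀ c ∈ uDisc, ∀ᶠ z in 𝓝[≠] c, w z ≠ 0 := by
    intro c hc
    have han : AnalyticOnNhd ℂ w uDisc := hwd.analyticOnNhd hU
    refine (han c hc).eventually_eq_zero_or_eventually_ne_zero.resolve_left fun h => ?_
    obtain ⟨z, hz, hwz⟩ := hne
    exact hwz (han.eqOn_zero_of_preconnected_of_eventuallyEq_zero
      (convex_ball 0 1).isPreconnected hc h hz)
  have hlt : ∀ z ∈ uDisc, w z ≠ 0 → ‖g z / w z‖ < 1 := by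
    intro z hz hwz
    obtain ⟨E, hE⟩ := exists_clm_eq_wToFun_hardyW hz
    have ht := tendsto_clm_eW (E.comp T)
    by_contra! hge
    have hle : ‖w z‖ ≤ 0 := ge_of_tendsto' ht fun n => by
      rw [ContinuousLinearMap.comp_apply, hE, hTn z hz hwz, norm_mul, norm_pow]
      exact le_mul_of_one_le_right (norm_nonneg _) (one_le_pow₀ hge)
    exact hwz (norm_le_zero_iff.mp hle)
  obtain ⟨φ, hφd, hφm, hφq⟩ := exists_extension_div hU hwd hgd hwne hlt
  refine ⟨w, φ, hwd, hφd, hφm, fun f => ?_⟩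
  have hoff : ∀ z ∈ uDisc, w z ≠ 0 →
      wToFun hardyW (T f) z = w z * wToFun hardyW f (φ z) := by
    intro z hz hwz
    obtain ⟨E, hE⟩ := exists_clm_eq_wToFun_hardyW hz
    have h := (hasSum_clm_eW (E.comp T) f).tsum_eq
    rw [ContinuousLinearMap.comp_apply, hE] at h
    rw [← h, wToFun_hardyW, ← tsum_mul_left]
    refine tsum_congr fun n => ?_
    rw [ContinuousLinearMap.comp_apply, hE, hTn z hz hwz, hφq z hz hwz]
    ring
  intro c hc
  have hcn := hU.mem_nhds hc
  have hl : ContinuousAt (wToFun hardyW (T f)) c :=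
    (differentiableOn_wToFun_hardyW _).continuousOn.continuousAt hcn
  have hr : ContinuousAt (fun z => w z * wToFun hardyW f (φ z)) c :=
    (hwd.mul ((differentiableOn_wToFun_hardyW f).comp hφd hφm)).continuousOn.continuousAt hcn
  refine tendsto_nhds_unique_of_eventuallyEq (hl.tendsto.mono_left nhdsWithin_le_nhds)
    (hr.tendsto.mono_left (nhdsWithin_le_nhds (s := {c}ᶜ))) ?_
  filter_upwards [hwne c hc, nhdsWithin_le_nhds hcn] with z hwz hz using hoff z hz hwz

theorem IsWeightedCompOp.pow_mul_eq {T : WH2 →L[ℂ] WH2} (hT : IsWeightedCompOp T)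
    {n : ℕ} (hn : 1 ≤ n) {z : ℂ} (hz : z ∈ uDisc) :
    (wToFun hardyW (T (eW hardyW 0)) z) ^ (n - 1) * wToFun hardyW (T (eW hardyW n)) z =
      (wToFun hardyW (T (eW hardyW 1)) z) ^ n := by
  obtain ⟨w, φ, -, -, -, h⟩ := hT
  obtain ⟨m, rfl⟩ := Nat.exists_eq_add_of_le' hn
  simp only [h _ z hz, wToFun_hardyW_eW, Nat.add_sub_cancel]
  ring

/-- A bounded operator `T` on `H²(𝔻)` with `T e₀` not identically
zero and `T e₀ ∈ H^∞(𝔻)` is a weighted composition operator iff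
`(T e₀)^{n-1} T eₙ = (T e₁)ⁿ` for all `n ≥ 1`. -/
theorem statement3 (T : WH2 →L[ℂ] WH2)
    (hne : ∃ z ∈ uDisc, wToFun hardyW (T (eW hardyW 0)) z ≠ 0)
    (hbdd : ∃ M : ℝ, ∀ z ∈ uDisc, ‖wToFun hardyW (T (eW hardyW 0)) z‖ ≤ M) :
    IsWeightedCompOp T ↔
      ∀ n : ℕ, 1 ≤ n → ∀ z ∈ uDisc,
        (wToFun hardyW (T (eW hardyW 0)) z) ^ (n - 1) *
            wToFun hardyW (T (eW hardyW n)) z =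
          (wToFun hardyW (T (eW hardyW 1)) z) ^ n := by
  exact ⟨fun h n hn z hz => h.pow_mul_eq hn hz, isWeightedCompOp_of_pow_mul_eq T hne⟩
end

section
/- Let (T(t))_{t≥0} be a C₀-semigroup of weighted composition operators on H²(𝔻). If T has an analytic extension to a sector Σ_θ, then T(ξ) is a weighted composition operator for every ξ ∈ Σ_θ. -/
open Complex MeasureTheory Filter Set Metric
open scoped Real Topology ENNReal

/-- A quotient `g / f` of analytic functions with `‖g‖ ≤ ‖f‖` and isolated zeros of `f` extends
analytically across those zeros. -/
theorem exists_differentiableOn_eq_mul {U : Set ℂ} (hU : IsOpen U) {f g : ℂ → ℂ}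
    (hf : DifferentiableOn ℂ f U) (hg : DifferentiableOn ℂ g U)
    (hne : ∀ c ∈ U, ∀ᶠ z in 𝓝[≠] c, f z ≠ 0) (hle : ∀ z ∈ U, ‖g z‖ ≤ ‖f z‖) :
    ∃ φ : ℂ → ℂ, DifferentiableOn ℂ φ U ∧ (∀ z ∈ U, ‖φ z‖ ≤ 1) ∧
      ∀ z ∈ U, g z = φ z * f z := by
  set q : ℂ → ℂ := fun z => g z / f z with hq
  have hq1 : ∀ z ∈ U, ‖q z‖ ≤ 1 := fun z hz => by
    rw [hq, norm_div]
    exact div_le_one_of_le₀ (hle z hz) (norm_nonneg _)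
  have hqd : ∀ z ∈ U, f z ≠ 0 → DifferentiableAt ℂ q z := fun z hz h0 =>
    ((hg z hz).differentiableAt (hU.mem_nhds hz)).div
      ((hf z hz).differentiableAt (hU.mem_nhds hz)) h0
  let φ : ℂ → ℂ := fun z => limUnder (𝓝[≠] z) q
  have hφq : ∀ z ∈ U, f z ≠ 0 → φ z = q z := fun z hz h0 =>
    ((hqd z hz h0).continuousAt.tendsto.mono_left nhdsWithin_le_nhds).limUnder_eq
  have hφd : ∀ c ∈ U, DifferentiableAt ℂ φ c := by
    intro c hc
    obtain ⟨ε, hε, hball⟩ := Metric.mem_nhdsWithin_iff.1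
      (inter_mem (hne c hc) (mem_nhdsWithin_of_mem_nhds (hU.mem_nhds hc)))
    have hmem : ∀ z ∈ ball c ε \ {c}, f z ≠ 0 ∧ z ∈ U := fun z hz => hball ⟨hz.1, hz.2⟩
    have hnhds : ball c ε ∈ 𝓝 c := ball_mem_nhds c hε
    have hupd := Complex.differentiableOn_update_limUnder_of_bddAbove (f := q) hnhds
      (fun z hz => (hqd z (hmem z hz).2 (hmem z hz).1).differentiableWithinAt)
      ⟨1, by
        rintro _ ⟨z, hz, rfl⟩
        exact hq1 z (hmem z hz).2⟩
    refine (hupd.differentiableAt hnhds).congr_of_eventuallyEq ?_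
    filter_upwards [hnhds] with z hz
    by_cases hzc : z = c
    · subst hzc
      simp [φ]
    · rw [Function.update_of_ne hzc, hφq z (hmem z ⟨hz, hzc⟩).2 (hmem z ⟨hz, hzc⟩).1]
  have hev : ∀ c ∈ U, ∀ᶠ z in 𝓝[≠] c, z ∈ U ∧ f z ≠ 0 := fun c hc =>
    (eventually_nhdsWithin_of_eventually_nhds (hU.mem_nhds hc)).and (hne c hc)
  refine ⟨φ, fun z hz => (hφd z hz).differentiableWithinAt, fun c hc => ?_, fun c hc => ?_⟩
  · refine le_of_tendsto
      ((hφd c hc).continuousAt.norm.tendsto.mono_left (nhdsWithin_le_nhds (s := {c}ᶜ))) ?_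
    filter_upwards [hev c hc] with z hz
    rw [hφq z hz.1 hz.2]
    exact hq1 z hz.1
  · by_cases h0 : f c = 0
    · have := hle c hc
      rw [h0, norm_zero, norm_le_zero_iff] at this
      rw [this, h0, mul_zero]
    · rw [hφq c hc h0, hq, div_mul_cancel₀ _ h0]

/-- A bounded functional on `ℓ²` tends to zero along the standard basis. -/
theorem tendsto_apply_single_zero (L : WH2 →L[ℂ] ℂ) :
    Tendsto (fun n : ℕ => L (lp.single 2 n 1)) atTop (𝓝 0) := by
  set g : WH2 := (InnerProductSpace.toDual ℂ WH2).symm L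
  have hL : ∀ n : ℕ, ‖L (lp.single 2 n 1)‖ = ‖g n‖ := fun n => by
    rw [← InnerProductSpace.toDual_symm_apply (𝕜 := ℂ), lp.inner_single_right]
    simp [g]
  have hs : Summable fun n : ℕ => ‖g n‖ ^ (2 : ℝ) := by
    simpa using (memℓp_gen_iff (p := 2) (by simp)).1 (lp.memℓp g)
  rw [tendsto_zero_iff_norm_tendsto_zero]
  simp only [hL]
  have h2 := (hs.tendsto_atTop_zero).rpow_const (p := 1 / 2) (Or.inr (by norm_num))
  refine (h2.congr fun n => ?_).trans (by simp)
  rw [← Real.rpow_mul (norm_nonneg _)]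
  norm_num

/-- Point evaluations at points of the disc are bounded on `H²(𝔻)`. -/
theorem exists_wToFun_hardyW_clm {z : ℂ} (hz : z ∈ uDisc) :
    ∃ L : WH2 →L[ℂ] ℂ, ∀ f : WH2, L f = wToFun hardyW f z := by
  have hz1 : ‖z‖ < 1 := by simpa [uDisc] using hz
  have hk : Memℓp (fun n : ℕ => (starRingEnd ℂ) (z ^ n)) 2 := by
    rw [memℓp_gen_iff (by simp)]
    have : Summable fun n : ℕ => (‖z‖ ^ 2) ^ n :=
      summable_geometric_of_lt_one (by positivity)
        (pow_lt_one₀ (norm_nonneg _) hz1 two_ne_zero)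
    refine this.congr fun n => ?_
    simp [← pow_mul, mul_comm]
  refine ⟨innerSL ℂ (⟨_, hk⟩ : WH2), fun f => ?_⟩
  rw [innerSL_apply_apply, lp.inner_eq_tsum]
  simp [wToFun, hardyW]

theorem wToFun_hardyW_single (n : ℕ) (z : ℂ) :
    wToFun hardyW (lp.single 2 n 1) z = z ^ n := by
  rw [wToFun, tsum_eq_single n]
  · simp [hardyW]
  · intro m hm
    simp [hm]

/-- The expansion of `T f` along the monomial basis, evaluated at a point of the disc. -/
theorem hasSum_wToFun_hardyW_apply (S : WH2 →L[ℂ] WH2) (f : WH2) {z : ℂ} (hz : z ∈ uDisc) :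
    HasSum (fun n : ℕ => f n * wToFun hardyW (S (lp.single 2 n 1)) z)
      (wToFun hardyW (S f) z) := by
  obtain ⟨L, hL⟩ := exists_wToFun_hardyW_clm hz
  have h := (lp.hasSum_single (E := fun _ : ℕ => ℂ) (p := 2) (by simp) f).mapL (L.comp S)
  simp only [ContinuousLinearMap.comp_apply, hL] at h
  refine h.congr_fun fun n => ?_
  have : lp.single (E := fun _ : ℕ => ℂ) 2 n (f n) = f n • lp.single 2 n 1 := by
    rw [← lp.single_smul]
    simp
  rw [← hL, ← hL, this, map_smul, map_smul, smul_eq_mul]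

/-- A bounded operator on `H²(𝔻)` is a weighted composition operator as soon as it satisfies
the multiplicativity relation of such operators on monomials. -/
theorem isWeightedCompOp_of_mul_eq {S : WH2 →L[ℂ] WH2}
    (h : ∀ z ∈ uDisc, ∀ m n : ℕ,
      wToFun hardyW (S (lp.single 2 (m + n) 1)) z * wToFun hardyW (S (lp.single 2 0 1)) z =
        wToFun hardyW (S (lp.single 2 m 1)) z * wToFun hardyW (S (lp.single 2 n 1)) z) :
    IsWeightedCompOp S := by
  set F : ℕ → ℂ → ℂ := fun n => wToFun hardyW (S (lp.single 2 n 1)) with hF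
  change ∀ z ∈ uDisc, ∀ m n : ℕ, F (m + n) z * F 0 z = F m z * F n z at h
  have hopen : IsOpen uDisc := isOpen_ball
  have hconn : IsPreconnected uDisc := (convex_ball _ _).isPreconnected
  have hFd : ∀ n, DifferentiableOn ℂ (F n) uDisc := fun n => differentiableOn_wToFun_hardyW _
  -- It suffices to describe the images of the monomials.
  have key : ∀ φ : ℂ → ℂ, DifferentiableOn ℂ φ uDisc → MapsTo φ uDisc uDisc →
      (∀ z ∈ uDisc, ∀ n, F n z = F 0 z * φ z ^ n) → IsWeightedCompOp S := by
    intro φ hφ hmaps hpow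
    refine ⟨F 0, φ, hFd 0, hφ, hmaps, fun f z hz => ?_⟩
    refine (hasSum_wToFun_hardyW_apply S f hz).unique ?_
    have h1 := (hasSum_wToFun_hardyW_apply 1 f (hmaps hz)).mul_left (F 0 z)
    refine h1.congr_fun fun n => ?_
    change f n * F n z = _
    rw [hpow z hz n]
    simp only [one_apply_eq_self, wToFun_hardyW_single]
    ring
  by_cases hzero : ∀ z ∈ uDisc, F 0 z = 0
  · refine key 0 (differentiableOn_const 0) (fun z _ => by simp [uDisc]) fun z hz n => ?_
    have := h z hz n n
    rw [hzero z hz, mul_zero] at this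
    rw [hzero z hz, zero_mul]
    exact mul_self_eq_zero.1 this.symm
  push Not at hzero
  obtain ⟨z₀, hz₀, hFz₀⟩ := hzero
  have hne : ∀ c ∈ uDisc, ∀ᶠ z in 𝓝[≠] c, F 0 z ≠ 0 := by
    intro c hc
    by_contra hcon
    have hfr : ∃ᶠ z in 𝓝[≠] c, F 0 z = 0 := 
      (not_eventually.1 hcon).mono fun _ => not_not.1
    exact hFz₀ (((hFd 0).analyticOnNhd hopen).eqOn_zero_of_preconnected_of_frequently_eq_zero
      hconn hc hfr hz₀)
  have hpow : ∀ z ∈ uDisc, ∀ a : ℂ, F 0 z ≠ 0 → F 1 z = a * F 0 z →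
      ∀ n, F n z = F 0 z * a ^ n := by
    intro z hz a h0 h1 n
    induction n with
    | zero => simp
    | succ n ih =>
      apply mul_right_cancel₀ h0
      rw [h z hz, ih, h1]
      ring
  have hlt : ∀ z ∈ uDisc, ∀ a : ℂ, F 0 z ≠ 0 → F 1 z = a * F 0 z → ‖a‖ < 1 := by
    intro z hz a h0 h1
    obtain ⟨L, hL⟩ := exists_wToFun_hardyW_clm hz
    have ht := (tendsto_apply_single_zero (L.comp S)).const_mul (F 0 z)⁻¹
    rw [← tendsto_pow_atTop_nhds_zero_iff_norm_lt_one]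
    simp only [ContinuousLinearMap.comp_apply, hL, mul_zero] at ht
    refine ht.congr fun n => ?_
    change (F 0 z)⁻¹ * F n z = a ^ n
    rw [hpow z hz a h0 h1 n, inv_mul_cancel_left₀ h0]
  have hle : ∀ z ∈ uDisc, ‖F 1 z‖ ≤ ‖F 0 z‖ := by
    intro z hz
    by_cases h0 : F 0 z = 0
    · have := h z hz 1 1
      rw [h0, mul_zero] at this
      simp [mul_self_eq_zero.1 this.symm]
    · have := hlt z hz (F 1 z / F 0 z) h0 (div_mul_cancel₀ _ h0).symm
      rw [norm_div, div_lt_one (norm_pos_iff.2 h0)] at this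
      exact this.le
  obtain ⟨φ, hφ, hφ1, hφF⟩ := exists_differentiableOn_eq_mul hopen (hFd 0) (hFd 1) hne hle
  refine key φ hφ (fun z hz => ?_) fun z hz n => ?_
  · have hlt1 : ‖φ z‖ < 1 := by
      refine (hφ1 z hz).lt_of_ne fun heq => ?_
      have hmax : IsMaxOn (norm ∘ φ) uDisc z := fun w hw => by
        simpa [heq] using hφ1 w hw
      have := Complex.norm_eqOn_of_isPreconnected_of_isMaxOn hconn hopen hφ hz hmax hz₀
      simp only [Function.comp_apply, Function.const_apply, heq] at this
      exact (hlt z₀ hz₀ _ hFz₀ (hφF z₀ hz₀)).ne this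
    simpa [uDisc] using hlt1
  · by_cases h0 : F 0 z = 0
    · have := h z hz n n
      rw [h0, mul_zero] at this
      rw [h0, zero_mul, mul_self_eq_zero.1 this.symm]
    · exact hpow z hz _ h0 (hφF z hz) n

theorem IsWeightedCompOp.mul_eq {S : WH2 →L[ℂ] WH2} (hS : IsWeightedCompOp S) {z : ℂ}
    (hz : z ∈ uDisc) (m n : ℕ) :
    wToFun hardyW (S (lp.single 2 (m + n) 1)) z * wToFun hardyW (S (lp.single 2 0 1)) z =
      wToFun hardyW (S (lp.single 2 m 1)) z * wToFun hardyW (S (lp.single 2 n 1)) z := by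
  obtain ⟨w, φ, -, -, -, h⟩ := hS
  simp only [h _ z hz, wToFun_hardyW_single]
  ring

/-- An analytic function on a sector vanishing on the positive half-line vanishes. -/
theorem eq_zero_of_differentiableOn_sector {θ : ℝ} (hθ : θ ∈ Set.Ioc 0 (π / 2)) {H : ℂ → ℂ}
    (hH : DifferentiableOn ℂ H (Sector θ \ {0})) (h0 : ∀ t : ℝ, 0 < t → H t = 0) {ξ : ℂ}
    (hξ : ξ ∈ Sector θ \ {0}) : H ξ = 0 := by
  set U : Set ℂ := Complex.im ⁻¹' Ioo (-θ) θ with hU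
  have hopen : IsOpen U := isOpen_Ioo.preimage Complex.continuous_im
  have hconn : IsPreconnected U :=
    ((convex_Ioo (-θ) θ).is_linear_preimage Complex.imLm.isLinear).isPreconnected
  have hmaps : MapsTo Complex.exp U (Sector θ \ {0}) := by
    intro w hw
    have hw' : -θ < w.im ∧ w.im < θ := hw
    refine ⟨?_, Complex.exp_ne_zero w⟩
    have hπ := Real.pi_pos
    have harg : Complex.arg (Complex.exp w) = w.im := by
      rw [Complex.arg_exp, toIocMod_eq_self]
      constructor <;> linarith [hθ.2]
    change |Complex.arg (Complex.exp w)| < θ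
    rw [harg, abs_lt]
    exact hw
  have han : AnalyticOnNhd ℂ (H ∘ Complex.exp) U :=
    (hH.comp Complex.differentiable_exp.differentiableOn hmaps).analyticOnNhd hopen
  have hfreq : ∃ᶠ w in 𝓝[≠] (0 : ℂ), (H ∘ Complex.exp) w = 0 := by
    have ht : Tendsto (fun x : ℝ => (x : ℂ)) (𝓝[≠] 0) (𝓝[≠] 0) := by
      refine tendsto_nhdsWithin_iff.2 ⟨?_, ?_⟩
      · exact (Complex.continuous_ofReal.tendsto' 0 0 (by simp)).mono_left nhdsWithin_le_nhds
      · filter_upwards [self_mem_nhdsWithin] with x hx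
        simpa using hx
    refine ht.frequently (Frequently.of_forall fun x => ?_)
    simp only [Function.comp_apply, ← Complex.ofReal_exp]
    exact h0 _ (Real.exp_pos x)
  have hlog : Complex.log ξ ∈ U := by
    have : |Complex.arg ξ| < θ := hξ.1
    simpa [hU, abs_lt, Complex.log_im] using this
  have := han.eqOn_zero_of_preconnected_of_frequently_eq_zero hconn
    (by simpa [hU] using hθ.1) hfreq hlog
  simpa [Complex.exp_log hξ.2] using this

/-- If a `C₀`-semigroup of weighted composition operators on
`H²(𝔻)` has an analytic extension to a sector `Σ_θ`, then every operator of the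
extension is a weighted composition operator. -/
theorem statement4 (T : ℝ → WH2 →L[ℂ] WH2) (hT : IsC0Semigroup T)
    (hcomp : ∀ t : ℝ, 0 ≤ t → IsWeightedCompOp (T t))
    (θ : ℝ) (hθ : θ ∈ Set.Ioc 0 (π / 2))
    (Te : ℂ → WH2 →L[ℂ] WH2) (hTe : IsAnalyticExtension T θ Te) :
    ∀ ξ ∈ Sector θ, IsWeightedCompOp (Te ξ) := by
  intro ξ hξ
  obtain ⟨hext, hd, -⟩ := hTe
  by_cases hξ0 : ξ = 0
  · subst hξ0
    have := hext 0 le_rfl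
    rw [Complex.ofReal_zero] at this
    rw [this]
    exact hcomp 0 le_rfl
  refine isWeightedCompOp_of_mul_eq fun z hz m n => ?_
  obtain ⟨L, hL⟩ := exists_wToFun_hardyW_clm hz
  have hdiff : ∀ k : ℕ, DifferentiableOn ℂ
      (fun ζ => wToFun hardyW (Te ζ (lp.single 2 k 1)) z) (Sector θ \ {0}) := fun k => by
    simp only [← hL]
    exact L.differentiable.comp_differentiableOn (hd.clm_apply (differentiableOn_const _))
  refine sub_eq_zero.1 (eq_zero_of_differentiableOn_sector hθ
    (((hdiff (m + n)).mul (hdiff 0)).sub ((hdiff m).mul (hdiff n))) (fun t ht => ?_) ⟨hξ, hξ0⟩)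
  simp only [Pi.sub_apply, Pi.mul_apply, hext t ht.le]
  exact sub_eq_zero.2 ((hcomp t ht.le).mul_eq hz m n)
end
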